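/- For every multi-index length m there is a constant C such that for every w ∈ C_0^∞(ℝ_+×ℝ³), every product Γ^α of |α| ≤ m vector fields from Γ, every t ≥ 0 and x ∈ ℝ³: ⟨r⟩^{1/2} ⟨t−r⟩ |∂ Γ^α w(t,x)| ≤ C Σ_{|β|≤|α|+1} ‖Γ^β ∂w(t,·)‖_{L²(ℝ³)} + C Σ_{|β|≤|α|+1} ‖⟨t−r⟩ ∂² Γ^β w(t,·)‖_{L²(ℝ³)}, where ∂² denotes the collection of all second-order t,x-derivatives. -/

import Mathlib

open MeasureTheory

noncomputable section

/-- The partial derivative in the `i`-th coordinate direction on `ℝⁿ`. -/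
def pd {n : ℕ} (i : Fin n) (u : (Fin n → ℝ) → ℝ) : (Fin n → ℝ) → ℝ :=
  fun z => fderiv ℝ u z (Pi.single i 1)

/-- Iterated application of a family of first-order operators along a list of indices. -/
def opIter {α γ : Type*} (F : α → γ → γ) : List α → γ → γ
  | [] => id
  | i :: L => fun u => F i (opIter F L u)

/-- The ten vector fields Γ on ℝ×ℝ³ (coordinates: `0 = t`, `1,2,3 = x`):
`∂_t, ∂_{x₁}, ∂_{x₂}, ∂_{x₃}`, the rotations `Ω_{jk} = x_j∂_k - x_k∂_j` (`1 ≤ j < k ≤ 3`)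
and the boosts `Ω_{0k} = x_k∂_t + t∂_k` (`k = 1,2,3`). -/
def GammaField (i : Fin 10) (u : (Fin 4 → ℝ) → ℝ) : (Fin 4 → ℝ) → ℝ :=
  if i.val = 0 then pd 0 u
  else if i.val = 1 then pd 1 u
  else if i.val = 2 then pd 2 u
  else if i.val = 3 then pd 3 u
  else if i.val = 4 then fun z => z 1 * pd 2 u z - z 2 * pd 1 u z
  else if i.val = 5 then fun z => z 1 * pd 3 u z - z 3 * pd 1 u z
  else if i.val = 6 then fun z => z 2 * pd 3 u z - z 3 * pd 2 u z
  else if i.val = 7 then fun z => z 1 * pd 0 u z + z 0 * pd 1 u z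
  else if i.val = 8 then fun z => z 2 * pd 0 u z + z 0 * pd 2 u z
  else fun z => z 3 * pd 0 u z + z 0 * pd 3 u z

/-- The spatial radius `r = |x|` of a space-time point. -/
def rad (z : Fin 4 → ℝ) : ℝ := Real.sqrt ((z 1)^2 + (z 2)^2 + (z 3)^2)

/-- The d'Alembertian `□ = ∂_t² - Δ` on ℝ×ℝ³. -/
def Box (u : (Fin 4 → ℝ) → ℝ) : (Fin 4 → ℝ) → ℝ :=
  fun z => pd 0 (pd 0 u) z - pd 1 (pd 1 u) z - pd 2 (pd 2 u) z - pd 3 (pd 3 u) z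

/-- The `L²` norm in `x ∈ ℝ³` at fixed time `t`. -/
def L2x (f : (Fin 4 → ℝ) → ℝ) (t : ℝ) : ℝ :=
  Real.sqrt (∫ x : Fin 3 → ℝ, (f (Fin.cons t x))^2)

open scoped ENNReal NNReal

/-- The point of the unit sphere of `ℝ³` with polar angle `θ` (measured from the first coordinate
axis) and azimuth `φ`. -/
def spherePoint (θ φ : ℝ) : EuclideanSpace ℝ (Fin 3) :=
  !₂[Real.cos θ, Real.sin θ * Real.cos φ, Real.sin θ * Real.sin φ]

/-- The unit tangent vector to the meridian `θ ↦ spherePoint θ φ`. -/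
def sphereTangent (θ φ : ℝ) : EuclideanSpace ℝ (Fin 3) :=
  !₂[-Real.sin θ, Real.cos θ * Real.cos φ, Real.cos θ * Real.sin φ]

lemma norm_spherePoint (θ φ : ℝ) : ‖spherePoint θ φ‖ = 1 := by
  rw [EuclideanSpace.norm_eq, Real.sqrt_eq_one]
  simp only [spherePoint, Fin.sum_univ_three, Real.norm_eq_abs, sq_abs]
  simp
  nlinarith [Real.sin_sq_add_cos_sq θ, Real.sin_sq_add_cos_sq φ]

lemma norm_sphereTangent (θ φ : ℝ) : ‖sphereTangent θ φ‖ = 1 := by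
  rw [EuclideanSpace.norm_eq, Real.sqrt_eq_one]
  simp only [sphereTangent, Fin.sum_univ_three, Real.norm_eq_abs, sq_abs]
  simp
  nlinarith [Real.sin_sq_add_cos_sq θ, Real.sin_sq_add_cos_sq φ]

lemma inner_spherePoint_sphereTangent (θ φ : ℝ) :
    inner ℝ (spherePoint θ φ) (sphereTangent θ φ) = 0 := by
  simp [spherePoint, sphereTangent, PiLp.inner_apply, Fin.sum_univ_three]
  linear_combination Real.sin θ * Real.cos θ * Real.sin_sq_add_cos_sq φ

lemma hasDerivAt_spherePoint (θ φ : ℝ) :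
    HasDerivAt (fun s => spherePoint s φ) (sphereTangent θ φ) θ := by
  have h : HasDerivAt
      (fun s => ![Real.cos s, Real.sin s * Real.cos φ, Real.sin s * Real.sin φ])
      ![-Real.sin θ, Real.cos θ * Real.cos φ, Real.cos θ * Real.sin φ] θ := by
    refine hasDerivAt_pi.2 fun i => ?_
    fin_cases i
    · simpa using Real.hasDerivAt_cos θ
    · simpa using (Real.hasDerivAt_sin θ).mul_const (Real.cos φ)
    · simpa using (Real.hasDerivAt_sin θ).mul_const (Real.sin φ)
  exact (PiLp.hasFDerivAt_toLp (𝕜 := ℝ) (E := fun _ : Fin 3 => ℝ) 2 _).comp_hasDerivAt θ h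

lemma continuous_spherePoint : Continuous fun p : ℝ × ℝ => spherePoint p.2 p.1 := by
  unfold spherePoint
  refine (PiLp.continuous_toLp 2 _).comp (continuous_pi fun i => ?_)
  fin_cases i <;> simp <;> fun_prop

lemma contDiff_spherePoint (φ : ℝ) : ContDiff ℝ 1 fun s => spherePoint s φ := by
  rw [contDiff_euclidean]
  intro i
  fin_cases i <;> simp [spherePoint]
  · exact Real.contDiff_cos
  · exact Real.contDiff_sin.mul contDiff_const
  · exact Real.contDiff_sin.mul contDiff_const

lemma lintegral_euclideanSpace_fin_three (g : EuclideanSpace ℝ (Fin 3) → ℝ≥0∞)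
    (hg : Measurable g) :
    ∫⁻ y, g y = ∫⁻ z : ℝ, ∫⁻ p : ℝ × ℝ, g !₂[z, p.1, p.2] := by
  have h1 := (PiLp.volume_preserving_toLp (Fin 3)).lintegral_comp hg
  have h2 := (volume_preserving_piFinSuccAbove (fun _ : Fin 3 => ℝ) 0).symm.lintegral_comp
    (hg.comp (WithLp.measurable_toLp 2 _))
  have h3 := ((MeasurePreserving.id (volume : Measure ℝ)).prod
    (volume_preserving_finTwoArrow ℝ).symm).lintegral_comp
    ((hg.comp (WithLp.measurable_toLp 2 _)).comp
      (MeasurableEquiv.piFinSuccAbove (fun _ : Fin 3 => ℝ) 0).symm.measurable)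
  have h4 : Measurable fun a : ℝ × ℝ × ℝ => g !₂[a.1, a.2.1, a.2.2] := by
    refine hg.comp ((WithLp.measurable_toLp 2 _).comp (measurable_pi_lambda _ fun i => ?_))
    fin_cases i <;> simp <;> fun_prop
  rw [← h1]
  refine h2.symm.trans (h3.symm.trans ?_)
  rw [← lintegral_prod _ h4.aemeasurable]
  refine lintegral_congr fun a => ?_
  simp only [Function.comp]
  congr 2
  ext i
  fin_cases i <;> rfl

lemma lintegral_spherical_le (g : EuclideanSpace ℝ (Fin 3) → ℝ≥0∞) (hg : Measurable g) :
    ∫⁻ φ in Set.Ioo (0 : ℝ) 1, ∫⁻ θ in Set.Ioo (0 : ℝ) 1, ∫⁻ ρ in Set.Ioi (0 : ℝ),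
      ENNReal.ofReal ρ * (ENNReal.ofReal (ρ * Real.sin θ) * g (ρ • spherePoint θ φ))
      ≤ ∫⁻ y, g y := by
  have hsub : Set.Ioo (0 : ℝ) 1 ⊆ Set.Ioo (-Real.pi) Real.pi := fun x hx =>
    ⟨by linarith [hx.1, Real.pi_pos], by linarith [hx.2, Real.pi_gt_three]⟩
  have hm3 : Measurable fun a : (ℝ × ℝ) × ℝ =>
      g !₂[a.1.1, a.1.2 * Real.cos a.2, a.1.2 * Real.sin a.2] := by
    refine hg.comp ((WithLp.measurable_toLp 2 _).comp (measurable_pi_lambda _ fun i => ?_))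
    fin_cases i <;> simp <;> fun_prop
  have polar : ∀ F : ℝ × ℝ → ℝ≥0∞, Measurable F →
      ∫⁻ φ in Set.Ioo (0 : ℝ) 1, ∫⁻ κ in Set.Ioi (0 : ℝ),
        ENNReal.ofReal κ * F (κ * Real.cos φ, κ * Real.sin φ) ≤ ∫⁻ p, F p := by
    intro F hF
    have hm : Measurable fun p : ℝ × ℝ =>
        ENNReal.ofReal p.1 * F (p.1 * Real.cos p.2, p.1 * Real.sin p.2) := by fun_prop
    rw [← lintegral_comp_polarCoord_symm, polarCoord_target, Measure.volume_eq_prod,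
      ← Measure.prod_restrict]
    simp only [smul_eq_mul, polarCoord_symm_apply]
    rw [lintegral_prod_symm _ hm.aemeasurable]
    exact lintegral_mono_set hsub
  rw [lintegral_euclideanSpace_fin_three g hg]
  calc _ ≤ ∫⁻ φ in Set.Ioo (0 : ℝ) 1, ∫⁻ p : ℝ × ℝ, ENNReal.ofReal p.2 *
            g !₂[p.1, p.2 * Real.cos φ, p.2 * Real.sin φ] := by
        refine lintegral_mono fun φ => ?_
        have hmφ : Measurable fun p : ℝ × ℝ => ENNReal.ofReal p.2 *
            g !₂[p.1, p.2 * Real.cos φ, p.2 * Real.sin φ] :=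
          measurable_snd.ennreal_ofReal.mul
            (hm3.comp (measurable_id.prodMk measurable_const))
        refine le_trans (le_of_eq ?_) (polar _ hmφ)
        refine lintegral_congr fun θ => lintegral_congr fun ρ => ?_
        congr 3
        ext i
        fin_cases i <;> simp [spherePoint, mul_assoc]
    _ = ∫⁻ φ in Set.Ioo (0 : ℝ) 1, ∫⁻ z : ℝ, ∫⁻ κ in Set.Ioi (0 : ℝ), ENNReal.ofReal κ *
            g !₂[z, κ * Real.cos φ, κ * Real.sin φ] := by
        refine lintegral_congr fun φ => ?_
        have hmφ : Measurable fun p : ℝ × ℝ => ENNReal.ofReal p.2 *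
            g !₂[p.1, p.2 * Real.cos φ, p.2 * Real.sin φ] :=
          measurable_snd.ennreal_ofReal.mul
            (hm3.comp (measurable_id.prodMk measurable_const))
        rw [Measure.volume_eq_prod, lintegral_prod _ hmφ.aemeasurable]
        refine lintegral_congr fun z => ?_
        rw [← lintegral_indicator measurableSet_Ioi]
        refine lintegral_congr fun κ => ?_
        by_cases hκ : κ ∈ Set.Ioi (0 : ℝ)
        · simp [hκ]
        · have : ENNReal.ofReal κ = 0 := ENNReal.ofReal_of_nonpos (by simpa using hκ)
          simp [this, Set.indicator_of_notMem hκ]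
    _ = ∫⁻ z : ℝ, ∫⁻ φ in Set.Ioo (0 : ℝ) 1, ∫⁻ κ in Set.Ioi (0 : ℝ), ENNReal.ofReal κ *
            g !₂[z, κ * Real.cos φ, κ * Real.sin φ] := by
        rw [lintegral_lintegral_swap]
        refine Measurable.aemeasurable ?_
        refine Measurable.lintegral_prod_right' (f := fun a : (ℝ × ℝ) × ℝ => ENNReal.ofReal a.2 *
            g !₂[a.1.2, a.2 * Real.cos a.1.1, a.2 * Real.sin a.1.1]) ?_
        have : Measurable fun a : (ℝ × ℝ) × ℝ => ((a.1.2, a.2), a.1.1) := by fun_prop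
        exact measurable_snd.ennreal_ofReal.mul (hm3.comp this)
    _ ≤ _ := by
        refine lintegral_mono fun z => ?_
        refine polar (fun p => g !₂[z, p.1, p.2]) ?_
        refine hg.comp ((WithLp.measurable_toLp 2 _).comp (measurable_pi_lambda _ fun i => ?_))
        fin_cases i <;> simp <;> fun_prop

lemma radial_fourth_power_le {h : EuclideanSpace ℝ (Fin 3) → ℝ} (hh : ContDiff ℝ 1 h)
    (hc : HasCompactSupport h) {ω : EuclideanSpace ℝ (Fin 3)} (hω : ‖ω‖ = 1) {R : ℝ}
    (hR : 0 < R) :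
    ENNReal.ofReal (R ^ 2) * ‖h (R • ω)‖ₑ ^ 4 ≤
      ∫⁻ ρ in Set.Ioi (0 : ℝ), ENNReal.ofReal ρ * (ENNReal.ofReal ρ *
        (4 * (‖h (ρ • ω)‖ₑ ^ 3 * ‖fderiv ℝ h (ρ • ω)‖ₑ))) := by
  obtain ⟨T, hRT, hT⟩ : ∃ T, R ≤ T ∧ h (T • ω) = 0 := by
    obtain ⟨M, hM⟩ := hc.isCompact.isBounded.exists_norm_le
    refine ⟨max R (M + 1), le_max_left _ _, image_eq_zero_of_notMem_tsupport fun hmem => ?_⟩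
    have := hM _ hmem
    rw [norm_smul, hω, mul_one, Real.norm_eq_abs] at this
    linarith [le_abs_self (max R (M + 1)), le_max_right R (M + 1)]
  have hd : ∀ ρ : ℝ, HasDerivAt (fun s : ℝ => h (s • ω) ^ 4)
      (4 * h (ρ • ω) ^ 3 * fderiv ℝ h (ρ • ω) ω) ρ := by
    intro ρ
    have h1 : HasDerivAt (fun s : ℝ => s • ω) ω ρ := by
      simpa using (hasDerivAt_id ρ).smul_const ω
    have h2 := ((hh.differentiable one_ne_zero (ρ • ω)).hasFDerivAt.comp_hasDerivAt ρ h1).pow 4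
    convert! h2 using 1
  have hcd : ContDiff ℝ 1 (fun s : ℝ => h (s • ω) ^ 4) := by
    have : ContDiff ℝ 1 (fun s : ℝ => s • ω) := contDiff_id.smul contDiff_const
    exact (hh.comp this).pow 4
  have key := enorm_sub_le_lintegral_deriv_of_contDiffOn_Icc (hcd.contDiffOn (s := Set.Icc R T)) hRT
  have e1 : ‖h (T • ω) ^ 4 - h (R • ω) ^ 4‖ₑ = ‖h (R • ω)‖ₑ ^ 4 := by
    rw [hT]; simp [enorm_pow]
  rw [e1] at key
  calc _ ≤ ENNReal.ofReal (R ^ 2) *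
        ∫⁻ ρ in Set.Icc R T, ‖deriv (fun s : ℝ => h (s • ω) ^ 4) ρ‖ₑ := by gcongr
    _ = ∫⁻ ρ in Set.Icc R T,
        ENNReal.ofReal (R ^ 2) * ‖deriv (fun s : ℝ => h (s • ω) ^ 4) ρ‖ₑ := by
        rw [lintegral_const_mul' _ _ ENNReal.ofReal_ne_top]
    _ ≤ ∫⁻ ρ in Set.Icc R T, ENNReal.ofReal ρ * (ENNReal.ofReal ρ *
        (4 * (‖h (ρ • ω)‖ₑ ^ 3 * ‖fderiv ℝ h (ρ • ω)‖ₑ))) := by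
        refine setLIntegral_mono' measurableSet_Icc fun ρ hρ => ?_
        rw [(hd ρ).deriv, ← mul_assoc, sq, ENNReal.ofReal_mul hR.le]
        have h3 : ‖4 * h (ρ • ω) ^ 3 * fderiv ℝ h (ρ • ω) ω‖ₑ ≤
            4 * (‖h (ρ • ω)‖ₑ ^ 3 * ‖fderiv ℝ h (ρ • ω)‖ₑ) := by
          rw [enorm_mul, enorm_mul, enorm_pow, mul_assoc]
          have h4 : ‖(4 : ℝ)‖ₑ = 4 := by simp [enorm_eq_nnnorm]
          have h5 : ‖fderiv ℝ h (ρ • ω) ω‖ₑ ≤ ‖fderiv ℝ h (ρ • ω)‖ₑ := by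
            have h6 := (fderiv ℝ h (ρ • ω)).le_opNorm ω
            rw [hω, mul_one] at h6
            exact enorm_le_iff_norm_le.2 h6
          rw [h4]
          gcongr
        have h7 : ENNReal.ofReal R ≤ ENNReal.ofReal ρ := ENNReal.ofReal_le_ofReal hρ.1
        gcongr
    _ ≤ _ := lintegral_mono_set fun ρ hρ => lt_of_lt_of_le hR hρ.1

lemma lintegral_sphere_fourth_power_le {h : EuclideanSpace ℝ (Fin 3) → ℝ} (hh : ContDiff ℝ 1 h)
    (hc : HasCompactSupport h)
    (Q : EuclideanSpace ℝ (Fin 3) ≃ₗᵢ[ℝ] EuclideanSpace ℝ (Fin 3)) {R : ℝ} (hR : 0 < R) :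
    ENNReal.ofReal (R ^ 2) * ∫⁻ φ in Set.Ioo (0 : ℝ) 1, ∫⁻ θ in Set.Ioo (0 : ℝ) 1,
        ENNReal.ofReal (Real.sin θ) * ‖h (R • Q (spherePoint θ φ))‖ₑ ^ 4 ≤
      ∫⁻ y, 4 * (‖h y‖ₑ ^ 3 * ‖fderiv ℝ h y‖ₑ) := by
  have hD : Continuous (fderiv ℝ h) := hh.continuous_fderiv one_ne_zero
  have hm : Measurable fun y => 4 * (‖h y‖ₑ ^ 3 * ‖fderiv ℝ h y‖ₑ) := by
    have := hh.continuous.measurable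
    have := hD.measurable
    fun_prop
  have hmQ : Measurable fun y => 4 * (‖h (Q y)‖ₑ ^ 3 * ‖fderiv ℝ h (Q y)‖ₑ) :=
    hm.comp Q.continuous.measurable
  rw [← Q.measurePreserving.lintegral_comp hm]
  refine le_trans ?_ (lintegral_spherical_le _ hmQ)
  rw [← lintegral_const_mul' _ _ ENNReal.ofReal_ne_top]
  refine lintegral_mono fun φ => ?_
  rw [← lintegral_const_mul' _ _ ENNReal.ofReal_ne_top]
  refine setLIntegral_mono' measurableSet_Ioo fun θ hθ => ?_
  have hω : ‖Q (spherePoint θ φ)‖ = 1 := by rw [Q.norm_map, norm_spherePoint]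
  calc _ = ENNReal.ofReal (Real.sin θ) *
        (ENNReal.ofReal (R ^ 2) * ‖h (R • Q (spherePoint θ φ))‖ₑ ^ 4) := by ring
    _ ≤ _ := mul_le_mul_right (radial_fourth_power_le hh hc hω hR) _
    _ = _ := by
        rw [← lintegral_const_mul' _ _ ENNReal.ofReal_ne_top]
        refine setLIntegral_congr_fun measurableSet_Ioi fun ρ hρ => ?_
        simp only [map_smul]
        rw [ENNReal.ofReal_mul (le_of_lt hρ)]
        ring

lemma exists_lintegral_cube_mul_fderiv_le : ∃ C : ℝ≥0,
    ∀ h : EuclideanSpace ℝ (Fin 3) → ℝ, ContDiff ℝ 1 h → HasCompactSupport h →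
      ∫⁻ y, 4 * (‖h y‖ₑ ^ 3 * ‖fderiv ℝ h y‖ₑ) ≤ C * eLpNorm (fderiv ℝ h) 2 volume ^ 4 := by
  set K : ℝ≥0 := SNormLESNormFDerivOfEqConst ℝ
    (volume : Measure (EuclideanSpace ℝ (Fin 3))) 2
  refine ⟨4 * K ^ 3, fun h hh hc => ?_⟩
  have hK : eLpNorm h 6 volume ≤ K * eLpNorm (fderiv ℝ h) 2 volume := by
    have := eLpNorm_le_eLpNorm_fderiv_of_eq (volume : Measure (EuclideanSpace ℝ (Fin 3))) hh hc
      (p := 2) (p' := 6) (by norm_num) (by simp) (by simp; norm_num)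
    simpa using this
  have hD : Continuous (fderiv ℝ h) := hh.continuous_fderiv one_ne_zero
  have m1 : Measurable h := hh.continuous.measurable
  have m2 : Measurable (fderiv ℝ h) := hD.measurable
  have hH := ENNReal.lintegral_mul_le_Lp_mul_Lq (volume : Measure (EuclideanSpace ℝ (Fin 3)))
    Real.HolderConjugate.two_two (f := fun y => ‖h y‖ₑ ^ 3) (g := fun y => ‖fderiv ℝ h y‖ₑ)
    (by fun_prop) (by fun_prop)
  have e2 : (∫⁻ y, ‖fderiv ℝ h y‖ₑ ^ (2 : ℝ)) ^ (1 / (2 : ℝ)) = eLpNorm (fderiv ℝ h) 2 volume := by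
    rw [eLpNorm_eq_lintegral_rpow_enorm_toReal (by simp) (by simp)]
    simp
  have e6 : (∫⁻ y, (‖h y‖ₑ ^ 3) ^ (2 : ℝ)) ^ (1 / (2 : ℝ)) = eLpNorm h 6 volume ^ 3 := by
    rw [eLpNorm_eq_lintegral_rpow_enorm_toReal (by simp) (by simp), ← ENNReal.rpow_natCast,
      ← ENNReal.rpow_mul]
    simp_rw [← ENNReal.rpow_natCast, ← ENNReal.rpow_mul]
    norm_num
  rw [e2, e6] at hH
  rw [lintegral_const_mul' _ _ (by simp)]
  calc _ ≤ 4 * (eLpNorm h 6 volume ^ 3 * eLpNorm (fderiv ℝ h) 2 volume) := by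
        gcongr; exact hH
    _ ≤ 4 * ((K * eLpNorm (fderiv ℝ h) 2 volume) ^ 3 * eLpNorm (fderiv ℝ h) 2 volume) := by
        gcongr
    _ = _ := by push_cast; ring

lemma lintegral_sin_rpow_lt_top :
    ∫⁻ θ in Set.Ioo (0 : ℝ) 1, ENNReal.ofReal (Real.sin θ) ^ (-(1 / 3) : ℝ) < ⊤ := by
  have hi : IntegrableOn (fun θ : ℝ => (θ / 2) ^ (-(1 / 3) : ℝ)) (Set.Ioo 0 1) := by
    have h0 := (intervalIntegral.intervalIntegrable_rpow' (a := 0) (b := 1)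
      (r := (-(1 / 3) : ℝ)) (by norm_num)).1
    have h1 : IntegrableOn (fun θ : ℝ => θ ^ (-(1 / 3) : ℝ) / 2 ^ (-(1 / 3) : ℝ)) (Set.Ioo 0 1) :=
      (h0.mono_set Set.Ioo_subset_Ioc_self).div_const _
    refine h1.congr_fun (fun θ hθ => ?_) measurableSet_Ioo
    exact (Real.div_rpow hθ.1.le (by norm_num) _).symm
  refine lt_of_le_of_lt (setLIntegral_mono' measurableSet_Ioo fun θ hθ => ?_) hi.2
  have h1 : 0 < θ / 2 := by linarith [hθ.1]
  have h2 : θ / 2 ≤ Real.sin θ := by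
    have := Real.mul_le_sin hθ.1.le (by linarith [hθ.2, Real.pi_gt_three])
    have h3 : 1 / 2 ≤ 2 / Real.pi := by
      rw [div_le_div_iff₀ (by norm_num) Real.pi_pos]; linarith [Real.pi_le_four]
    nlinarith [hθ.1]
  rw [ENNReal.ofReal_rpow_of_pos (by linarith), Real.enorm_eq_ofReal (by positivity)]
  exact ENNReal.ofReal_le_ofReal (Real.rpow_le_rpow_of_nonpos h1 h2 (by norm_num))

/-- Trace estimate on spherical caps: the `L¹` norm, in polar angles, of `h` on a cap of the sphere
of radius `R` is bounded by `R^{-1/2}` times the `L²` norm of the gradient. -/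
lemma exists_lintegral_cap_le : ∃ C : ℝ≥0,
    ∀ h : EuclideanSpace ℝ (Fin 3) → ℝ, ContDiff ℝ 1 h → HasCompactSupport h →
      ∀ (Q : EuclideanSpace ℝ (Fin 3) ≃ₗᵢ[ℝ] EuclideanSpace ℝ (Fin 3)) (R : ℝ), 0 < R →
      ENNReal.ofReal √R * ∫⁻ φ in Set.Ioo (0 : ℝ) 1, ∫⁻ θ in Set.Ioo (0 : ℝ) 1,
        ‖h (R • Q (spherePoint θ φ))‖ₑ ≤ C * eLpNorm (fderiv ℝ h) 2 volume := by
  obtain ⟨C, hC⟩ := exists_lintegral_cube_mul_fderiv_le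
  set J := ∫⁻ θ in Set.Ioo (0 : ℝ) 1, ENNReal.ofReal (Real.sin θ) ^ (-(1 / 3) : ℝ) with hJ
  have hJt : J ≠ ⊤ := lintegral_sin_rpow_lt_top.ne
  refine ⟨C ^ (1 / 4 : ℝ) * J.toNNReal ^ (3 / 4 : ℝ), fun h hh hc Q R hR => ?_⟩
  set I := Set.Ioo (0 : ℝ) 1
  set ν := ((volume : Measure ℝ).restrict I).prod ((volume : Measure ℝ).restrict I)
  have hmh : Measurable fun p : ℝ × ℝ => ‖h (R • Q (spherePoint p.2 p.1))‖ₑ :=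
    (hh.continuous.comp ((Q.continuous.comp continuous_spherePoint).const_smul R)).measurable.enorm
  have hms : Measurable fun p : ℝ × ℝ => ENNReal.ofReal (Real.sin p.2) := by fun_prop
  have htr := (lintegral_sphere_fourth_power_le hh hc Q hR).trans (hC h hh hc)
  have e1 : ∫⁻ φ in I, ∫⁻ θ in I, ENNReal.ofReal (Real.sin θ) *
      ‖h (R • Q (spherePoint θ φ))‖ₑ ^ 4 =
      ∫⁻ p, ENNReal.ofReal (Real.sin p.2) * ‖h (R • Q (spherePoint p.2 p.1))‖ₑ ^ 4 ∂ν := by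
    exact (lintegral_prod _ (hms.mul (hmh.pow_const 4)).aemeasurable).symm
  have e2 : ∫⁻ φ in I, ∫⁻ θ in I, ‖h (R • Q (spherePoint θ φ))‖ₑ =
      ∫⁻ p, ‖h (R • Q (spherePoint p.2 p.1))‖ₑ ∂ν := by
    rw [lintegral_prod _ hmh.aemeasurable]
  have e3 : ∫⁻ p, ENNReal.ofReal (Real.sin p.2) ^ (-(1 / 3) : ℝ) ∂ν = J := by
    rw [lintegral_prod _ (hms.pow_const _).aemeasurable]
    simp [I, hJ]
  rw [e1] at htr
  rw [e2]
  have hconj : Real.HolderConjugate 4 (4 / 3) := by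
    rw [Real.holderConjugate_iff]; norm_num
  have hH := ENNReal.lintegral_mul_le_Lp_mul_Lq ν hconj
    (f := fun p => ENNReal.ofReal (Real.sin p.2) ^ (1 / 4 : ℝ) *
      ‖h (R • Q (spherePoint p.2 p.1))‖ₑ)
    (g := fun p => ENNReal.ofReal (Real.sin p.2) ^ (-(1 / 4) : ℝ))
    ((hms.pow_const _).mul hmh).aemeasurable (hms.pow_const _).aemeasurable
  have e4 : ∫⁻ p, ‖h (R • Q (spherePoint p.2 p.1))‖ₑ ∂ν ≤
      ∫⁻ p, ((fun p : ℝ × ℝ => ENNReal.ofReal (Real.sin p.2) ^ (1 / 4 : ℝ) *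
      ‖h (R • Q (spherePoint p.2 p.1))‖ₑ) *
      fun p : ℝ × ℝ => ENNReal.ofReal (Real.sin p.2) ^ (-(1 / 4) : ℝ)) p ∂ν := by
    have hν : ν = (volume : Measure (ℝ × ℝ)).restrict (I ×ˢ I) := by
      rw [Measure.volume_eq_prod, ← Measure.prod_restrict]
    rw [hν]
    refine setLIntegral_mono' (measurableSet_Ioo.prod measurableSet_Ioo) fun p hp => ?_
    have hpos : 0 < Real.sin p.2 := Real.sin_pos_of_pos_of_lt_pi hp.2.1
      (by linarith [hp.2.2, Real.pi_gt_three])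
    simp only [Pi.mul_apply]
    rw [mul_right_comm, ← ENNReal.rpow_add _ _ (by simpa using hpos) (by simp)]
    simp
  have e5 : ∀ p : ℝ × ℝ, (ENNReal.ofReal (Real.sin p.2) ^ (1 / 4 : ℝ) *
      ‖h (R • Q (spherePoint p.2 p.1))‖ₑ) ^ (4 : ℝ) =
      ENNReal.ofReal (Real.sin p.2) * ‖h (R • Q (spherePoint p.2 p.1))‖ₑ ^ 4 := by
    intro p
    rw [ENNReal.mul_rpow_of_nonneg _ _ (by norm_num), ← ENNReal.rpow_mul]
    norm_num
  have e6 : ∀ p : ℝ × ℝ, (ENNReal.ofReal (Real.sin p.2) ^ (-(1 / 4) : ℝ)) ^ (4 / 3 : ℝ) =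
      ENNReal.ofReal (Real.sin p.2) ^ (-(1 / 3) : ℝ) := by
    intro p
    rw [← ENNReal.rpow_mul]; norm_num
  simp only [e5, e6] at hH
  rw [e3] at hH
  have e7 : ENNReal.ofReal √R = ENNReal.ofReal (R ^ 2) ^ (1 / 4 : ℝ) := by
    rw [ENNReal.ofReal_rpow_of_nonneg (by positivity) (by norm_num), Real.sqrt_eq_rpow,
      ← Real.rpow_natCast, ← Real.rpow_mul hR.le]
    norm_num
  calc _ ≤ ENNReal.ofReal (R ^ 2) ^ (1 / 4 : ℝ) *
        ((∫⁻ p, ENNReal.ofReal (Real.sin p.2) * ‖h (R • Q (spherePoint p.2 p.1))‖ₑ ^ 4 ∂ν) ^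
          (1 / 4 : ℝ) * J ^ (1 / (4 / 3) : ℝ)) := by
        rw [e7]; gcongr; exact e4.trans hH
    _ = (ENNReal.ofReal (R ^ 2) *
        ∫⁻ p, ENNReal.ofReal (Real.sin p.2) * ‖h (R • Q (spherePoint p.2 p.1))‖ₑ ^ 4 ∂ν) ^
          (1 / 4 : ℝ) * J ^ (3 / 4 : ℝ) := by
        rw [ENNReal.mul_rpow_of_nonneg _ _ (by norm_num), mul_assoc]; norm_num
    _ ≤ (C * eLpNorm (fderiv ℝ h) 2 volume ^ 4) ^ (1 / 4 : ℝ) * J ^ (3 / 4 : ℝ) := by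
        gcongr
    _ = _ := by
        rw [ENNReal.mul_rpow_of_nonneg _ _ (by norm_num), ← ENNReal.rpow_natCast,
          ← ENNReal.rpow_mul]
        push_cast
        rw [ENNReal.coe_rpow_of_nonneg _ (by norm_num), ENNReal.coe_rpow_of_nonneg _ (by norm_num),
          ENNReal.coe_toNNReal hJt]
        norm_num
        ring

lemma enorm_le_lintegral_meridian {ι : Type} [Fintype ι] {f : EuclideanSpace ℝ (Fin 3) → ℝ}
    (hf : ContDiff ℝ 1 f) {h : ι → EuclideanSpace ℝ (Fin 3) → ℝ}
    (Q : EuclideanSpace ℝ (Fin 3) ≃ₗᵢ[ℝ] EuclideanSpace ℝ (Fin 3)) {R : ℝ} (hR : 0 < R)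
    (H : ∀ y v, ‖y‖ = R → ‖v‖ = R → inner ℝ y v = 0 →
      |f y| + |fderiv ℝ f y v| ≤ ∑ i, |h i y|) (φ : ℝ) :
    ‖f (R • Q (spherePoint 0 φ))‖ₑ ≤
      ∫⁻ θ in Set.Ioo (0 : ℝ) 1, ∑ i, ‖h i (R • Q (spherePoint θ φ))‖ₑ := by
  have hy : ∀ θ : ℝ, HasDerivAt (fun s => R • Q (spherePoint s φ))
      (R • Q (sphereTangent θ φ)) θ := fun θ =>
    ((Q.toContinuousLinearEquiv.hasFDerivAt (x := spherePoint θ φ)).comp_hasDerivAt θ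
      (hasDerivAt_spherePoint θ φ)).const_smul R
  have hd : ∀ θ : ℝ, HasDerivAt (fun s => (1 - s) * f (R • Q (spherePoint s φ)))
      (-1 * f (R • Q (spherePoint θ φ)) + (1 - θ) *
        fderiv ℝ f (R • Q (spherePoint θ φ)) (R • Q (sphereTangent θ φ))) θ := fun θ =>
    ((hasDerivAt_id θ).const_sub 1).mul
      ((hf.differentiable one_ne_zero _).hasFDerivAt.comp_hasDerivAt θ (hy θ))
  have hcd : ContDiff ℝ 1 (fun s => (1 - s) * f (R • Q (spherePoint s φ))) :=
    (contDiff_const.sub contDiff_id).mul (hf.comp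
      ((Q.toContinuousLinearEquiv.contDiff.comp (contDiff_spherePoint φ)).const_smul R))
  have key := enorm_sub_le_lintegral_deriv_of_contDiffOn_Icc
    (hcd.contDiffOn (s := Set.Icc 0 1)) zero_le_one
  simp only [sub_self, zero_mul, sub_zero, one_mul, zero_sub, enorm_neg] at key
  rw [← restrict_Ioo_eq_restrict_Icc] at key
  refine key.trans (setLIntegral_mono' measurableSet_Ioo fun θ hθ => ?_)
  rw [(hd θ).deriv]
  set y := R • Q (spherePoint θ φ)
  set v := R • Q (sphereTangent θ φ)
  have hH := H y v (by simp [y, norm_smul, norm_spherePoint, abs_of_pos hR])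
    (by simp [v, norm_smul, norm_sphereTangent, abs_of_pos hR])
    (by simp [y, v, inner_smul_left, inner_smul_right, Q.inner_map_map,
      inner_spherePoint_sphereTangent])
  have h1 : |(-1 * f y + (1 - θ) * fderiv ℝ f y v)| ≤ ∑ i, |h i y| := by
    refine le_trans ?_ hH
    refine (abs_add_le _ _).trans ?_
    rw [abs_mul, abs_mul, abs_of_pos (by linarith [hθ.2] : 0 < 1 - θ)]
    have : (1 - θ) * |fderiv ℝ f y v| ≤ 1 * |fderiv ℝ f y v| := by
      gcongr; linarith [hθ.1]
    simp only [abs_neg, abs_one]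
    linarith
  rw [Real.enorm_eq_ofReal_abs]
  simp_rw [Real.enorm_eq_ofReal_abs]
  rw [← ENNReal.ofReal_sum_of_nonneg fun i _ => abs_nonneg _]
  exact ENNReal.ofReal_le_ofReal h1

/-- Weighted Sobolev estimate: a function is controlled at `x`, with a gain `|x|^{1/2}`, by
functions dominating it and its derivatives tangential to the sphere through `x`. -/
lemma exists_sqrt_norm_mul_enorm_le : ∃ C : ℝ≥0,
    ∀ (ι : Type) [Fintype ι] (f : EuclideanSpace ℝ (Fin 3) → ℝ)
      (h : ι → EuclideanSpace ℝ (Fin 3) → ℝ) (x : EuclideanSpace ℝ (Fin 3)), x ≠ 0 →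
      ContDiff ℝ 1 f → (∀ i, ContDiff ℝ 1 (h i)) → (∀ i, HasCompactSupport (h i)) →
      (∀ y v, ‖y‖ = ‖x‖ → ‖v‖ = ‖x‖ → inner ℝ y v = 0 →
        |f y| + |fderiv ℝ f y v| ≤ ∑ i, |h i y|) →
      ENNReal.ofReal √‖x‖ * ‖f x‖ₑ ≤ C * ∑ i, eLpNorm (fderiv ℝ (h i)) 2 volume := by
  obtain ⟨C, hC⟩ := exists_lintegral_cap_le
  refine ⟨C, fun ι _ f h x hx hf hh hc H => ?_⟩
  have hR : 0 < ‖x‖ := norm_pos_iff.2 hx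
  set e : EuclideanSpace ℝ (Fin 3) := spherePoint 0 0
  have hex : ‖e‖ = ‖(‖x‖⁻¹ • x)‖ := by
    rw [norm_spherePoint, norm_smul]; simp [hR.ne']
  obtain ⟨Q, hQ⟩ : ∃ Q : EuclideanSpace ℝ (Fin 3) ≃ₗᵢ[ℝ] EuclideanSpace ℝ (Fin 3),
      Q e = ‖x‖⁻¹ • x := ⟨_, Submodule.reflection_sub hex⟩
  have hpole : ∀ φ, ‖x‖ • Q (spherePoint 0 φ) = x := by
    intro φ
    have : spherePoint 0 φ = e := by simp [e, spherePoint]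
    rw [this, hQ, smul_smul, mul_inv_cancel₀ hR.ne', one_smul]
  have hm : ∀ i, Measurable fun p : ℝ × ℝ => ‖h i (‖x‖ • Q (spherePoint p.2 p.1))‖ₑ := fun i =>
    ((hh i).continuous.comp
      ((Q.continuous.comp continuous_spherePoint).const_smul ‖x‖)).measurable.enorm
  have hmθ : ∀ i φ, Measurable fun θ => ‖h i (‖x‖ • Q (spherePoint θ φ))‖ₑ := fun i φ =>
    ((hh i).continuous.comp ((Q.continuous.comp
      (contDiff_spherePoint φ).continuous).const_smul ‖x‖)).measurable.enorm
  have hmer : ∀ φ, ‖f x‖ₑ ≤ ∑ i, ∫⁻ θ in Set.Ioo (0 : ℝ) 1,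
      ‖h i (‖x‖ • Q (spherePoint θ φ))‖ₑ := by
    intro φ
    have h2 := enorm_le_lintegral_meridian hf Q hR H φ
    rw [hpole φ, lintegral_finsetSum (f := fun i θ => ‖h i (‖x‖ • Q (spherePoint θ φ))‖ₑ) _
      fun i _ => hmθ i φ] at h2
    exact h2
  have h1 : ‖f x‖ₑ ≤ ∑ i, ∫⁻ φ in Set.Ioo (0 : ℝ) 1, ∫⁻ θ in Set.Ioo (0 : ℝ) 1,
      ‖h i (‖x‖ • Q (spherePoint θ φ))‖ₑ := by
    rw [← lintegral_finsetSum (f := fun i φ => ∫⁻ θ in Set.Ioo (0 : ℝ) 1,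
      ‖h i (‖x‖ • Q (spherePoint θ φ))‖ₑ) _ fun i _ => (hm i).lintegral_prod_right']
    calc ‖f x‖ₑ = ∫⁻ φ in Set.Ioo (0 : ℝ) 1, ‖f x‖ₑ := by simp
      _ ≤ _ := lintegral_mono hmer
  calc _ ≤ ENNReal.ofReal √‖x‖ * _ := mul_le_mul_right h1 _
    _ = ∑ i, ENNReal.ofReal √‖x‖ * ∫⁻ φ in Set.Ioo (0 : ℝ) 1, ∫⁻ θ in Set.Ioo (0 : ℝ) 1,
      ‖h i (‖x‖ • Q (spherePoint θ φ))‖ₑ := Finset.mul_sum _ _ _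
    _ ≤ ∑ i, C * eLpNorm (fderiv ℝ (h i)) 2 volume :=
        Finset.sum_le_sum fun i _ => hC _ (hh i) (hc i) Q _ hR
    _ = _ := (Finset.mul_sum _ _ _).symm

lemma pd_eq_fderiv_single {n : ℕ} (i : Fin n) (u : (Fin n → ℝ) → ℝ) (z : Fin n → ℝ) :
    pd i u z = fderiv ℝ u z (Pi.single i 1) := rfl

lemma contDiff_pd {n : ℕ} (i : Fin n) {u : (Fin n → ℝ) → ℝ} (hu : ContDiff ℝ (⊤ : ℕ∞) u) :
    ContDiff ℝ (⊤ : ℕ∞) (pd i u) :=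
  (hu.fderiv_right (m := (⊤ : ℕ∞)) (by exact_mod_cast le_top)).clm_apply contDiff_const

lemma hasCompactSupport_pd {n : ℕ} (i : Fin n) {u : (Fin n → ℝ) → ℝ} (hu : HasCompactSupport u) :
    HasCompactSupport (pd i u) :=
  hu.fderiv_apply (𝕜 := ℝ) (Pi.single i 1)

lemma pd_add {n : ℕ} (i : Fin n) {u v : (Fin n → ℝ) → ℝ} (hu : ContDiff ℝ (⊤ : ℕ∞) u)
    (hv : ContDiff ℝ (⊤ : ℕ∞) v) (z : Fin n → ℝ) :
    pd i (fun z => u z + v z) z = pd i u z + pd i v z := by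
  have h := fderiv_fun_add (hu.differentiable (by simp) z) (hv.differentiable (by simp) z)
  simp [pd, h]

lemma pd_mul {n : ℕ} (i : Fin n) {u v : (Fin n → ℝ) → ℝ} (hu : ContDiff ℝ (⊤ : ℕ∞) u)
    (hv : ContDiff ℝ (⊤ : ℕ∞) v) (z : Fin n → ℝ) :
    pd i (fun z => u z * v z) z = pd i u z * v z + u z * pd i v z := by
  have h := fderiv_fun_mul (hu.differentiable (by simp) z) (hv.differentiable (by simp) z)
  simp [pd, h]
  ring

lemma pd_sum {n : ℕ} {ι : Type*} (s : Finset ι) (i : Fin n) {u : ι → (Fin n → ℝ) → ℝ}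
    (hu : ∀ j, ContDiff ℝ (⊤ : ℕ∞) (u j)) (z : Fin n → ℝ) :
    pd i (fun z => ∑ j ∈ s, u j z) z = ∑ j ∈ s, pd i (u j) z := by
  have h := fderiv_fun_sum (u := s) (A := u) (x := z) (𝕜 := ℝ)
    (fun j _ => (hu j).differentiable (by simp) z)
  simp [pd, h]

lemma pd_const_mul {n : ℕ} (i : Fin n) (a : ℝ) {u : (Fin n → ℝ) → ℝ}
    (hu : ContDiff ℝ (⊤ : ℕ∞) u) (z : Fin n → ℝ) :
    pd i (fun z => a * u z) z = a * pd i u z := by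
  have h := fderiv_const_mul (hu.differentiable (by simp) z) a
  simp [pd, h]

lemma pd_comm {n : ℕ} (i j : Fin n) {u : (Fin n → ℝ) → ℝ} (hu : ContDiff ℝ (⊤ : ℕ∞) u)
    (z : Fin n → ℝ) : pd i (pd j u) z = pd j (pd i u) z := by
  have hd : DifferentiableAt ℝ (fderiv ℝ u) z :=
    (hu.fderiv_right (m := (⊤ : ℕ∞)) (by exact_mod_cast le_top)).differentiable (by simp) z
  have h : ∀ k l : Fin n, pd k (pd l u) z =
      fderiv ℝ (fderiv ℝ u) z (Pi.single k 1) (Pi.single l 1) := by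
    intro k l
    have := hd.hasFDerivAt.clm_apply (hasFDerivAt_const (Pi.single l (1 : ℝ) : Fin n → ℝ) z)
    rw [pd_eq_fderiv_single, show pd l u = fun z => fderiv ℝ u z (Pi.single l 1) from rfl,
      this.fderiv]
    simp
  rw [h, h]
  exact (hu.contDiffAt.isSymmSndFDerivAt (by simpa using WithTop.coe_le_coe.2 (le_top : (2 : ℕ∞) ≤ ⊤))).eq _ _

lemma pd_apply {n : ℕ} (i j : Fin n) (z : Fin n → ℝ) :
    pd i (fun z : Fin n → ℝ => z j) z = if j = i then 1 else 0 := by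
  have h : HasFDerivAt (fun z : Fin n → ℝ => z j) (ContinuousLinearMap.proj (R := ℝ) j) z :=
    (ContinuousLinearMap.proj (R := ℝ) (φ := fun _ : Fin n => ℝ) j).hasFDerivAt
  rw [pd_eq_fderiv_single, h.fderiv]
  simp [Pi.single_apply]

/-- Each of the fields `Γ` is a first-order operator with affine coefficients. -/
lemma exists_gammaField_eq_sum (c : Fin 10) : ∃ (e : Fin 4 → ℝ) (M : Fin 4 → Fin 4 → ℝ),
    (∀ j k, |M j k| ≤ 1) ∧ ∀ u z,
      GammaField c u z = ∑ j, (e j + ∑ k, M j k * z k) * pd j u z := by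
  have hM : ∀ M : Matrix (Fin 4) (Fin 4) ℤ, (∀ j k, |M j k| ≤ 1) →
      ∀ j k, |(M j k : ℝ)| ≤ 1 := fun M h j k => by exact_mod_cast h j k
  fin_cases c
  · exact ⟨![1, 0, 0, 0], fun _ _ => 0, by simp, by simp [GammaField, Fin.sum_univ_four]⟩
  · exact ⟨![0, 1, 0, 0], fun _ _ => 0, by simp, by simp [GammaField, Fin.sum_univ_four]⟩
  · exact ⟨![0, 0, 1, 0], fun _ _ => 0, by simp, by simp [GammaField, Fin.sum_univ_four]⟩
  · exact ⟨![0, 0, 0, 1], fun _ _ => 0, by simp, by simp [GammaField, Fin.sum_univ_four]⟩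
  · exact ⟨0, fun j k => (!![0, 0, 0, 0; 0, 0, -1, 0; 0, 1, 0, 0; 0, 0, 0, 0] j k : ℤ),
      hM _ (by decide), fun u z => by simp [GammaField, Fin.sum_univ_four]; ring⟩
  · exact ⟨0, fun j k => (!![0, 0, 0, 0; 0, 0, 0, -1; 0, 0, 0, 0; 0, 1, 0, 0] j k : ℤ),
      hM _ (by decide), fun u z => by simp [GammaField, Fin.sum_univ_four]; ring⟩
  · exact ⟨0, fun j k => (!![0, 0, 0, 0; 0, 0, 0, 0; 0, 0, 0, -1; 0, 0, 1, 0] j k : ℤ),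
      hM _ (by decide), fun u z => by simp [GammaField, Fin.sum_univ_four]; ring⟩
  · exact ⟨0, fun j k => (!![0, 1, 0, 0; 1, 0, 0, 0; 0, 0, 0, 0; 0, 0, 0, 0] j k : ℤ),
      hM _ (by decide), fun u z => by simp [GammaField, Fin.sum_univ_four]⟩
  · exact ⟨0, fun j k => (!![0, 0, 1, 0; 0, 0, 0, 0; 1, 0, 0, 0; 0, 0, 0, 0] j k : ℤ),
      hM _ (by decide), fun u z => by simp [GammaField, Fin.sum_univ_four]⟩
  · exact ⟨0, fun j k => (!![0, 0, 0, 1; 0, 0, 0, 0; 0, 0, 0, 0; 1, 0, 0, 0] j k : ℤ),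
      hM _ (by decide), fun u z => by simp [GammaField, Fin.sum_univ_four]⟩

lemma contDiff_affine (a : ℝ) (m : Fin 4 → ℝ) :
    ContDiff ℝ (⊤ : ℕ∞) fun z : Fin 4 → ℝ => a + ∑ k, m k * z k :=
  contDiff_const.add (ContDiff.sum fun k _ => contDiff_const.mul (contDiff_apply ℝ ℝ k))

lemma contDiff_gammaField (c : Fin 10) {u : (Fin 4 → ℝ) → ℝ} (hu : ContDiff ℝ (⊤ : ℕ∞) u) :
    ContDiff ℝ (⊤ : ℕ∞) (GammaField c u) := by
  obtain ⟨e, M, -, h⟩ := exists_gammaField_eq_sum c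
  rw [show GammaField c u = _ from funext (h u)]
  exact ContDiff.sum fun j _ => (contDiff_affine _ _).mul (contDiff_pd j hu)

lemma hasCompactSupport_gammaField (c : Fin 10) {u : (Fin 4 → ℝ) → ℝ} (hu : HasCompactSupport u) :
    HasCompactSupport (GammaField c u) := by
  obtain ⟨e, M, -, h⟩ := exists_gammaField_eq_sum c
  refine hu.mono' fun z hz => ?_
  by_contra hzu
  refine hz ?_
  rw [h]
  refine Finset.sum_eq_zero fun j _ => ?_
  have : pd j u z = 0 := by
    rw [pd_eq_fderiv_single, fderiv_of_notMem_tsupport ℝ hzu]; simp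
  rw [this, mul_zero]

lemma contDiff_opIter (L : List (Fin 10)) {u : (Fin 4 → ℝ) → ℝ} (hu : ContDiff ℝ (⊤ : ℕ∞) u) :
    ContDiff ℝ (⊤ : ℕ∞) (opIter GammaField L u) := by
  induction L with
  | nil => exact hu
  | cons c L ih => exact contDiff_gammaField c ih

lemma hasCompactSupport_opIter (L : List (Fin 10)) {u : (Fin 4 → ℝ) → ℝ}
    (hu : HasCompactSupport u) : HasCompactSupport (opIter GammaField L u) := by
  induction L with
  | nil => exact hu
  | cons c L ih => exact hasCompactSupport_gammaField c ih

lemma opIter_append {α γ : Type*} (F : α → γ → γ) (L₁ L₂ : List α) (u : γ) :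
    opIter F (L₁ ++ L₂) u = opIter F L₁ (opIter F L₂ u) := by
  induction L₁ with
  | nil => rfl
  | cons c L ih => exact congrArg (F c) ih

lemma pd_add_sum_mul (i : Fin 4) (b : Fin 4 → ℝ) {u : (Fin 4 → ℝ) → ℝ}
    {v : Fin 4 → (Fin 4 → ℝ) → ℝ} (hu : ContDiff ℝ (⊤ : ℕ∞) u)
    (hv : ∀ j, ContDiff ℝ (⊤ : ℕ∞) (v j)) (z : Fin 4 → ℝ) :
    pd i (fun z => u z + ∑ j, b j * v j z) z = pd i u z + ∑ j, b j * pd i (v j) z := by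
  rw [pd_add i hu (ContDiff.sum fun j _ => contDiff_const.mul (hv j)),
    pd_sum _ _ fun j => contDiff_const.mul (hv j)]
  simp_rw [pd_const_mul i _ (hv _)]

lemma opIter_add_sum_mul (L : List (Fin 10)) (b : Fin 4 → ℝ) {u : (Fin 4 → ℝ) → ℝ}
    {v : Fin 4 → (Fin 4 → ℝ) → ℝ} (hu : ContDiff ℝ (⊤ : ℕ∞) u)
    (hv : ∀ j, ContDiff ℝ (⊤ : ℕ∞) (v j)) :
    opIter GammaField L (fun z => u z + ∑ j, b j * v j z) =
      fun z => opIter GammaField L u z + ∑ j, b j * opIter GammaField L (v j) z := by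
  induction L with
  | nil => rfl
  | cons c L ih =>
    funext z
    change GammaField c (opIter GammaField L _) z = GammaField c _ z + ∑ j, b j * GammaField c _ z
    obtain ⟨e, M, -, h⟩ := exists_gammaField_eq_sum c
    rw [ih]
    simp only [h]
    simp_rw [pd_add_sum_mul _ b (contDiff_opIter L hu) fun j => contDiff_opIter L (hv j)]
    simp only [Fin.sum_univ_four]
    ring

/-- Commuting a partial derivative with one of the fields `Γ` produces first-order terms with
constant coefficients. -/
lemma exists_pd_gammaField (c : Fin 10) (i : Fin 4) : ∃ b : Fin 4 → ℝ, (∀ j, |b j| ≤ 1) ∧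
    ∀ u : (Fin 4 → ℝ) → ℝ, ContDiff ℝ (⊤ : ℕ∞) u →
      pd i (GammaField c u) = fun z => GammaField c (pd i u) z + ∑ j, b j * pd j u z := by
  obtain ⟨e, M, hM, h⟩ := exists_gammaField_eq_sum c
  refine ⟨fun j => M j i, fun j => hM j i, fun u hu => funext fun z => ?_⟩
  rw [show GammaField c u = _ from funext (h u), h,
    pd_sum _ _ fun j => (contDiff_affine _ _).mul (contDiff_pd j hu)]
  have haff : ∀ j, pd i (fun z : Fin 4 → ℝ => e j + ∑ k, M j k * z k) z = M j i := by
    intro j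
    rw [pd_add_sum_mul i (M j) contDiff_const fun k => contDiff_apply ℝ ℝ k]
    simp_rw [pd_apply]
    simp [pd]
  simp_rw [pd_mul i (contDiff_affine _ _) (contDiff_pd _ hu), haff, pd_comm i _ hu,
    Finset.sum_add_distrib]
  ring

lemma eLpNorm_le_sum_mul {α ι F : Type*} [Fintype ι] [MeasurableSpace α] {μ : Measure α}
    [NormedAddCommGroup F] {f : α → F} {g : ι → α → ℝ} {a : ι → ℝ} (ha : ∀ i, 0 ≤ a i)
    (hg : ∀ i, AEStronglyMeasurable (g i) μ) (H : ∀ x, ‖f x‖ ≤ ∑ i, a i * |g i x|) :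
    eLpNorm f 2 μ ≤ ∑ i, ENNReal.ofReal (a i) * eLpNorm (g i) 2 μ := by
  calc eLpNorm f 2 μ ≤ eLpNorm (∑ i, a i • fun x => ‖g i x‖) 2 μ :=
        eLpNorm_mono_real fun x => by simpa using H x
    _ ≤ ∑ i, eLpNorm (a i • fun x => ‖g i x‖) 2 μ :=
        eLpNorm_sum_le (fun i _ => (hg i).norm.const_smul _) (by norm_num)
    _ = _ := by
        simp_rw [eLpNorm_const_smul, eLpNorm_norm, Real.enorm_eq_ofReal (ha _)]

lemma continuous_finCons (t : ℝ) : Continuous fun x : Fin 3 → ℝ => (Fin.cons t x : Fin 4 → ℝ) :=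
  continuous_pi fun i => Fin.cases continuous_const (fun k => continuous_apply k) i

lemma hasCompactSupport_comp_finCons {f : (Fin 4 → ℝ) → ℝ} (hc : HasCompactSupport f) (t : ℝ) :
    HasCompactSupport fun x : Fin 3 → ℝ => f (Fin.cons t x) := by
  have hinv : Function.LeftInverse (fun z : Fin 4 → ℝ => Fin.tail z)
      (fun x : Fin 3 → ℝ => (Fin.cons t x : Fin 4 → ℝ)) := fun x => rfl
  exact hc.comp_isClosedEmbedding
    (hinv.isClosedEmbedding (continuous_pi fun k => continuous_apply k.succ) (continuous_finCons t))

/-- The restriction of a function on space-time to the time slice at `t`. -/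
def timeSlice (t : ℝ) (f : (Fin 4 → ℝ) → ℝ) (y : EuclideanSpace ℝ (Fin 3)) : ℝ :=
  f (Fin.cons t (WithLp.ofLp y))

lemma hasCompactSupport_timeSlice {f : (Fin 4 → ℝ) → ℝ} (hc : HasCompactSupport f) (t : ℝ) :
    HasCompactSupport (timeSlice t f) :=
  (hasCompactSupport_comp_finCons hc t).comp_homeomorph
    (EuclideanSpace.equiv (Fin 3) ℝ).toHomeomorph

lemma continuous_timeSlice {f : (Fin 4 → ℝ) → ℝ} (hf : Continuous f) (t : ℝ) :
    Continuous (timeSlice t f) :=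
  (hf.comp (continuous_finCons t)).comp (PiLp.continuous_ofLp 2 _)

lemma eLpNorm_timeSlice {f : (Fin 4 → ℝ) → ℝ} (hf : Continuous f) (hc : HasCompactSupport f)
    (t : ℝ) : eLpNorm (timeSlice t f) 2 volume = ENNReal.ofReal (L2x f t) := by
  have hcont := hf.comp (continuous_finCons t)
  have hm : MemLp (fun x : Fin 3 → ℝ => f (Fin.cons t x)) 2 volume :=
    hcont.memLp_of_hasCompactSupport (hasCompactSupport_comp_finCons hc t)
  have h1 : eLpNorm (timeSlice t f) 2 volume =
      eLpNorm (fun x : Fin 3 → ℝ => f (Fin.cons t x)) 2 volume :=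
    eLpNorm_comp_measurePreserving hm.1 (PiLp.volume_preserving_ofLp (Fin 3))
  rw [h1, hm.eLpNorm_eq_integral_rpow_norm (by norm_num) (by norm_num), L2x, Real.sqrt_eq_rpow]
  simp

lemma L2x_nonneg (f : (Fin 4 → ℝ) → ℝ) (t : ℝ) : 0 ≤ L2x f t := Real.sqrt_nonneg _

lemma L2x_le_sum_mul {ι : Type*} [Fintype ι] {f : (Fin 4 → ℝ) → ℝ} {g : ι → (Fin 4 → ℝ) → ℝ}
    {a : ι → ℝ} (ha : ∀ i, 0 ≤ a i) (hf : Continuous f) (hfc : HasCompactSupport f)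
    (hg : ∀ i, Continuous (g i)) (hgc : ∀ i, HasCompactSupport (g i))
    (H : ∀ z, |f z| ≤ ∑ i, a i * |g i z|) (t : ℝ) : L2x f t ≤ ∑ i, a i * L2x (g i) t := by
  have h := eLpNorm_le_sum_mul (μ := volume) (f := timeSlice t f) (g := fun i => timeSlice t (g i))
    ha (fun i => (continuous_timeSlice (hg i) t).aestronglyMeasurable) fun y => H _
  simp_rw [eLpNorm_timeSlice hf hfc, eLpNorm_timeSlice (hg _) (hgc _)] at h
  rw [← ENNReal.ofReal_le_ofReal_iff
    (Finset.sum_nonneg fun i _ => mul_nonneg (ha i) (L2x_nonneg _ _)),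
    ENNReal.ofReal_sum_of_nonneg fun i _ => mul_nonneg (ha i) (L2x_nonneg _ _)]
  simpa only [ENNReal.ofReal_mul (ha _)] using h

lemma hasFDerivAt_timeSlice {G : (Fin 4 → ℝ) → ℝ} (hG : ContDiff ℝ (⊤ : ℕ∞) G) (t : ℝ)
    (y : EuclideanSpace ℝ (Fin 3)) : HasFDerivAt (timeSlice t G)
      ((fderiv ℝ G (Fin.cons t (WithLp.ofLp y))).comp ((ContinuousLinearMap.pi fun i : Fin 4 =>
        (Fin.cases 0 (fun k => ContinuousLinearMap.proj k) i : (Fin 3 → ℝ) →L[ℝ] ℝ)).comp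
        (EuclideanSpace.equiv (Fin 3) ℝ : EuclideanSpace ℝ (Fin 3) →L[ℝ] (Fin 3 → ℝ)))) y := by
  refine (hG.differentiable (by simp) _).hasFDerivAt.comp y ?_
  refine HasFDerivAt.comp (g := fun x : Fin 3 → ℝ => (Fin.cons t x : Fin 4 → ℝ)) y ?_
    (EuclideanSpace.equiv (Fin 3) ℝ).hasFDerivAt
  refine hasFDerivAt_pi.2 fun i => ?_
  refine Fin.cases ?_ (fun k => ?_) i
  · exact hasFDerivAt_const t _
  · exact (ContinuousLinearMap.proj (R := ℝ) (φ := fun _ : Fin 3 => ℝ) k).hasFDerivAt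

lemma fderiv_timeSlice {G : (Fin 4 → ℝ) → ℝ} (hG : ContDiff ℝ (⊤ : ℕ∞) G) (t : ℝ)
    (y v : EuclideanSpace ℝ (Fin 3)) :
    fderiv ℝ (timeSlice t G) y v = ∑ k, v k * timeSlice t (pd k.succ G) y := by
  rw [(hasFDerivAt_timeSlice hG t y).fderiv]
  have hv : (ContinuousLinearMap.pi fun i : Fin 4 =>
      (Fin.cases 0 (fun k => ContinuousLinearMap.proj k) i : (Fin 3 → ℝ) →L[ℝ] ℝ))
      (EuclideanSpace.equiv (Fin 3) ℝ v) = ∑ k, v k • Pi.single (Fin.succ k) (1 : ℝ) := by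
    funext i
    refine Fin.cases ?_ (fun k => ?_) i
    · simp
    · simp [Pi.single_apply]
  change fderiv ℝ G _ ((ContinuousLinearMap.pi fun i : Fin 4 => _)
    (EuclideanSpace.equiv (Fin 3) ℝ v)) = _
  rw [hv, map_sum]
  simp_rw [map_smul, smul_eq_mul]
  rfl

lemma contDiff_timeSlice {G : (Fin 4 → ℝ) → ℝ} (hG : ContDiff ℝ (⊤ : ℕ∞) G) (t : ℝ) :
    ContDiff ℝ 1 (timeSlice t G) := by
  have h : ContDiff ℝ 1 fun x : Fin 3 → ℝ => (Fin.cons t x : Fin 4 → ℝ) :=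
    contDiff_pi.2 fun i => Fin.cases contDiff_const (fun k => contDiff_apply ℝ ℝ k) i
  exact ((hG.of_le (by exact_mod_cast le_top)).comp h).comp
    (EuclideanSpace.equiv (Fin 3) ℝ).contDiff

lemma eLpNorm_fderiv_timeSlice_le {G : (Fin 4 → ℝ) → ℝ} (hG : ContDiff ℝ (⊤ : ℕ∞) G)
    (hc : HasCompactSupport G) (t : ℝ) : eLpNorm (fderiv ℝ (timeSlice t G)) 2 volume ≤
      ∑ k : Fin 3, ENNReal.ofReal (L2x (pd k.succ G) t) := by
  have h := eLpNorm_le_sum_mul (μ := volume) (f := fderiv ℝ (timeSlice t G))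
    (g := fun k : Fin 3 => timeSlice t (pd k.succ G)) (a := 1) (fun _ => zero_le_one)
    (fun k => (continuous_timeSlice (contDiff_pd _ hG).continuous t).aestronglyMeasurable)
    fun y => by
      refine ContinuousLinearMap.opNorm_le_bound _ (Finset.sum_nonneg fun k _ => by simp) fun v => ?_
      rw [fderiv_timeSlice hG, Finset.sum_mul]
      refine (norm_sum_le _ _).trans (Finset.sum_le_sum fun k _ => ?_)
      rw [norm_mul, mul_comm, Pi.one_apply, one_mul]
      exact mul_le_mul_of_nonneg_left (PiLp.norm_apply_le v k) (abs_nonneg _)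
  simpa [eLpNorm_timeSlice (contDiff_pd _ hG).continuous (hasCompactSupport_pd _ hc)] using h

/-- The weight `⟨t - r⟩`. -/
def coneWeight (z : Fin 4 → ℝ) : ℝ := √(1 + (z 0 - rad z) ^ 2)

/-- The smooth weight `⟨t - ⟨r⟩⟩`, comparable to `coneWeight`. -/
def smoothConeWeight (z : Fin 4 → ℝ) : ℝ :=
  √(1 + (z 0 - √(1 + (z 1 ^ 2 + z 2 ^ 2 + z 3 ^ 2))) ^ 2)

lemma continuous_coneWeight : Continuous coneWeight := by
  unfold coneWeight rad
  fun_prop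

lemma coneWeight_nonneg (z : Fin 4 → ℝ) : 0 ≤ coneWeight z := Real.sqrt_nonneg _

lemma one_le_smoothConeWeight (z : Fin 4 → ℝ) : 1 ≤ smoothConeWeight z := by
  rw [smoothConeWeight, Real.one_le_sqrt]
  nlinarith [sq_nonneg (z 0 - √(1 + (z 1 ^ 2 + z 2 ^ 2 + z 3 ^ 2)))]

lemma sqrt_one_add_sq_le {a b : ℝ} (h : |a - b| ≤ 1) : √(1 + a ^ 2) ≤ 2 * √(1 + b ^ 2) := by
  rw [show (2 : ℝ) * √(1 + b ^ 2) = √(4 * (1 + b ^ 2)) by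
    rw [Real.sqrt_mul (by norm_num), show (4 : ℝ) = 2 ^ 2 by norm_num,
      Real.sqrt_sq (by norm_num)]]
  have := abs_le.1 h
  exact Real.sqrt_le_sqrt (by nlinarith [sq_nonneg (a - 2 * b)])

lemma abs_sub_rad_sub_le (z : Fin 4 → ℝ) :
    |z 0 - rad z - (z 0 - √(1 + (z 1 ^ 2 + z 2 ^ 2 + z 3 ^ 2)))| ≤ 1 := by
  unfold rad
  set q := z 1 ^ 2 + z 2 ^ 2 + z 3 ^ 2
  have hq : 0 ≤ q := by positivity
  have h1 : √q ≤ √(1 + q) := Real.sqrt_le_sqrt (by linarith)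
  have h2 : √(1 + q) ≤ 1 + √q :=
    Real.sqrt_le_iff.2 ⟨by positivity, by nlinarith [Real.sq_sqrt hq, Real.sqrt_nonneg q]⟩
  rw [abs_le]
  constructor <;> linarith

lemma coneWeight_le (z : Fin 4 → ℝ) : coneWeight z ≤ 2 * smoothConeWeight z :=
  sqrt_one_add_sq_le (abs_sub_rad_sub_le z)

lemma smoothConeWeight_le (z : Fin 4 → ℝ) : smoothConeWeight z ≤ 2 * coneWeight z :=
  sqrt_one_add_sq_le (by rw [abs_sub_comm]; exact abs_sub_rad_sub_le z)

lemma contDiff_sqrt_one_add_sq :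
    ContDiff ℝ (⊤ : ℕ∞) fun z : Fin 4 → ℝ => √(1 + (z 1 ^ 2 + z 2 ^ 2 + z 3 ^ 2)) :=
  ContDiff.sqrt (by fun_prop) fun z => by positivity

lemma contDiff_smoothConeWeight : ContDiff ℝ (⊤ : ℕ∞) smoothConeWeight :=
  ContDiff.sqrt (contDiff_const.add (((contDiff_apply ℝ ℝ 0).sub contDiff_sqrt_one_add_sq).pow 2))
    fun z => by positivity

lemma pd_sqrt {n : ℕ} (i : Fin n) {u : (Fin n → ℝ) → ℝ} (hu : ContDiff ℝ (⊤ : ℕ∞) u)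
    {z : Fin n → ℝ} (hz : u z ≠ 0) : pd i (fun z => √(u z)) z = pd i u z / (2 * √(u z)) := by
  rw [pd_eq_fderiv_single, ((hu.differentiable (by simp) z).hasFDerivAt.sqrt hz).fderiv]
  simp [pd]
  ring

lemma pd_one_add_sq {n : ℕ} (i : Fin n) {u : (Fin n → ℝ) → ℝ} (hu : ContDiff ℝ (⊤ : ℕ∞) u)
    (z : Fin n → ℝ) : pd i (fun z => 1 + u z ^ 2) z = 2 * u z * pd i u z := by
  rw [pd_eq_fderiv_single,
    (((hu.differentiable (by simp) z).hasFDerivAt.pow 2).const_add 1).fderiv]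
  simp [pd]

lemma pd_smoothConeWeight (k : Fin 3) (z : Fin 4 → ℝ) :
    pd k.succ smoothConeWeight z = -((z 0 - √(1 + (z 1 ^ 2 + z 2 ^ 2 + z 3 ^ 2))) /
      smoothConeWeight z * (z k.succ / √(1 + (z 1 ^ 2 + z 2 ^ 2 + z 3 ^ 2)))) := by
  have hρ : pd k.succ (fun z : Fin 4 → ℝ => √(1 + (z 1 ^ 2 + z 2 ^ 2 + z 3 ^ 2))) z =
      z k.succ / √(1 + (z 1 ^ 2 + z 2 ^ 2 + z 3 ^ 2)) := by
    have h0 : 0 < 1 + (z 1 ^ 2 + z 2 ^ 2 + z 3 ^ 2) := by positivity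
    rw [pd_sqrt (u := fun z : Fin 4 → ℝ => 1 + (z 1 ^ 2 + z 2 ^ 2 + z 3 ^ 2)) _
      (by fun_prop) h0.ne']
    have h1 : pd k.succ (fun z : Fin 4 → ℝ => 1 + (z 1 ^ 2 + z 2 ^ 2 + z 3 ^ 2)) z =
        2 * z k.succ := by
      have hp : ∀ j : Fin 4, HasFDerivAt (fun z : Fin 4 → ℝ => z j)
          (ContinuousLinearMap.proj (R := ℝ) (φ := fun _ : Fin 4 => ℝ) j) z := fun j =>
        (ContinuousLinearMap.proj (R := ℝ) (φ := fun _ : Fin 4 => ℝ) j).hasFDerivAt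
      rw [pd_eq_fderiv_single,
        (((((hp 1).pow 2).fun_add ((hp 2).pow 2)).fun_add ((hp 3).pow 2)).const_add 1).fderiv]
      fin_cases k <;> simp
    rw [h1, mul_div_mul_left _ _ two_ne_zero]
  have hs : pd k.succ (fun z : Fin 4 → ℝ => z 0 - √(1 + (z 1 ^ 2 + z 2 ^ 2 + z 3 ^ 2))) z =
      -(z k.succ / √(1 + (z 1 ^ 2 + z 2 ^ 2 + z 3 ^ 2))) := by
    rw [← hρ, pd_eq_fderiv_single, fderiv_fun_sub (by fun_prop)
      (contDiff_sqrt_one_add_sq.differentiable (by simp) z), sub_apply]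
    have := pd_apply k.succ 0 z
    simp only [pd] at this ⊢
    rw [this, if_neg (Fin.succ_ne_zero k).symm, zero_sub]
  have hc : ContDiff ℝ (⊤ : ℕ∞)
      fun z : Fin 4 → ℝ => z 0 - √(1 + (z 1 ^ 2 + z 2 ^ 2 + z 3 ^ 2)) :=
    (contDiff_apply ℝ ℝ 0).sub contDiff_sqrt_one_add_sq
  change pd k.succ (fun z : Fin 4 → ℝ =>
      √(1 + (z 0 - √(1 + (z 1 ^ 2 + z 2 ^ 2 + z 3 ^ 2))) ^ 2)) z =
    -(_ / √(1 + (z 0 - √(1 + (z 1 ^ 2 + z 2 ^ 2 + z 3 ^ 2))) ^ 2) * _)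
  rw [pd_sqrt (u := fun z : Fin 4 → ℝ =>
    1 + (z 0 - √(1 + (z 1 ^ 2 + z 2 ^ 2 + z 3 ^ 2))) ^ 2) _ (contDiff_const.add (hc.pow 2))
    (by positivity), pd_one_add_sq _ hc, hs, mul_assoc, mul_div_mul_left _ _ two_ne_zero]
  ring

lemma abs_pd_smoothConeWeight_le (k : Fin 3) (z : Fin 4 → ℝ) :
    |pd k.succ smoothConeWeight z| ≤ 1 := by
  rw [pd_smoothConeWeight, abs_neg, abs_mul]
  refine mul_le_one₀ ?_ (abs_nonneg _) ?_
  · have h := one_le_smoothConeWeight z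
    rw [abs_div, abs_of_pos (zero_lt_one.trans_le h), div_le_one (by linarith)]
    exact Real.abs_le_sqrt (by linarith)
  · rw [abs_div, abs_of_nonneg (Real.sqrt_nonneg _), div_le_one (by positivity)]
    refine Real.abs_le_sqrt ?_
    fin_cases k <;> simp <;> nlinarith [sq_nonneg (z 1), sq_nonneg (z 2), sq_nonneg (z 3)]

lemma rotation_smoothConeWeight (j k : Fin 3) (z : Fin 4 → ℝ) :
    z j.succ * pd k.succ smoothConeWeight z = z k.succ * pd j.succ smoothConeWeight z := by
  rw [pd_smoothConeWeight, pd_smoothConeWeight]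
  ring

lemma le_sum_range_sum_ofFn {F : List (Fin 10) → ℝ} (hF : ∀ L, 0 ≤ F L) {L : List (Fin 10)}
    {N : ℕ} (h : L.length < N) :
    F L ≤ ∑ n ∈ Finset.range N, ∑ σ : Fin n → Fin 10, F (List.ofFn σ) := by
  calc F L = F (List.ofFn L.get) := by rw [List.ofFn_get]
    _ ≤ ∑ σ : Fin L.length → Fin 10, F (List.ofFn σ) :=
        Finset.single_le_sum (f := fun σ : Fin L.length → Fin 10 => F (List.ofFn σ))
          (fun σ _ => hF _) (Finset.mem_univ L.get)
    _ ≤ _ := Finset.single_le_sum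
        (f := fun n => ∑ σ : Fin n → Fin 10, F (List.ofFn σ))
        (fun n _ => Finset.sum_nonneg fun σ _ => hF _) (Finset.mem_range.2 h)

/-- The sum of the norms `‖Γ^β ∂w(t)‖` over `|β| < N`. -/
def gammaGradSum (w : (Fin 4 → ℝ) → ℝ) (t : ℝ) (N : ℕ) : ℝ :=
  ∑ n ∈ Finset.range N, ∑ σ : Fin n → Fin 10, ∑ j : Fin 4,
    L2x (opIter GammaField (List.ofFn σ) (pd j w)) t

/-- The sum of the norms `‖⟨t - r⟩ ∂²Γ^β w(t)‖` over `|β| < N`. -/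
def weightedHessSum (w : (Fin 4 → ℝ) → ℝ) (t : ℝ) (N : ℕ) : ℝ :=
  ∑ n ∈ Finset.range N, ∑ σ : Fin n → Fin 10, ∑ j : Fin 4, ∑ k : Fin 4,
    L2x (fun z => coneWeight z * pd j (pd k (opIter GammaField (List.ofFn σ) w)) z) t

lemma gammaGradSum_nonneg (w : (Fin 4 → ℝ) → ℝ) (t : ℝ) (N : ℕ) : 0 ≤ gammaGradSum w t N :=
  Finset.sum_nonneg fun _ _ => Finset.sum_nonneg fun _ _ => Finset.sum_nonneg fun _ _ =>
    L2x_nonneg _ _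

lemma weightedHessSum_nonneg (w : (Fin 4 → ℝ) → ℝ) (t : ℝ) (N : ℕ) :
    0 ≤ weightedHessSum w t N :=
  Finset.sum_nonneg fun _ _ => Finset.sum_nonneg fun _ _ => Finset.sum_nonneg fun _ _ =>
    Finset.sum_nonneg fun _ _ => L2x_nonneg _ _

lemma L2x_le_gammaGradSum (w : (Fin 4 → ℝ) → ℝ) (t : ℝ) {N : ℕ} {L : List (Fin 10)}
    (h : L.length < N) (j : Fin 4) :
    L2x (opIter GammaField L (pd j w)) t ≤ gammaGradSum w t N :=
  (Finset.single_le_sum (f := fun j => L2x (opIter GammaField L (pd j w)) t)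
    (fun _ _ => L2x_nonneg _ _) (Finset.mem_univ j)).trans
  (le_sum_range_sum_ofFn (F := fun L => ∑ j, L2x (opIter GammaField L (pd j w)) t)
    (fun _ => Finset.sum_nonneg fun _ _ => L2x_nonneg _ _) h)

lemma L2x_le_weightedHessSum (w : (Fin 4 → ℝ) → ℝ) (t : ℝ) {N : ℕ} {L : List (Fin 10)}
    (h : L.length < N) (j k : Fin 4) :
    L2x (fun z => coneWeight z * pd j (pd k (opIter GammaField L w)) z) t ≤
      weightedHessSum w t N :=
  (Finset.single_le_sum (f := fun k =>
    L2x (fun z => coneWeight z * pd j (pd k (opIter GammaField L w)) z) t)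
    (fun _ _ => L2x_nonneg _ _) (Finset.mem_univ k)).trans <|
  (Finset.single_le_sum (f := fun j => ∑ k,
    L2x (fun z => coneWeight z * pd j (pd k (opIter GammaField L w)) z) t)
    (fun _ _ => Finset.sum_nonneg fun _ _ => L2x_nonneg _ _) (Finset.mem_univ j)).trans
  (le_sum_range_sum_ofFn (F := fun L => ∑ j, ∑ k,
    L2x (fun z => coneWeight z * pd j (pd k (opIter GammaField L w)) z) t)
    (fun _ => Finset.sum_nonneg fun _ _ => Finset.sum_nonneg fun _ _ => L2x_nonneg _ _) h)

lemma L2x_add_sum_mul_le {p : (Fin 4 → ℝ) → ℝ} {q : Fin 4 → (Fin 4 → ℝ) → ℝ} {b : Fin 4 → ℝ}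
    (hb : ∀ j, |b j| ≤ 1) (hp : Continuous p) (hpc : HasCompactSupport p)
    (hq : ∀ j, Continuous (q j)) (hqc : ∀ j, HasCompactSupport (q j)) {t M : ℝ}
    (hpM : L2x p t ≤ M) (hqM : ∀ j, L2x (q j) t ≤ M) :
    L2x (fun z => p z + ∑ j, b j * q j z) t ≤ 5 * M := by
  have hc : HasCompactSupport fun z => p z + ∑ j, b j * q j z := by
    refine hpc.add ?_
    simp only [Fin.sum_univ_four]
    exact (((hqc 0).mul_left.add (hqc 1).mul_left).add (hqc 2).mul_left).add (hqc 3).mul_left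
  have h := L2x_le_sum_mul (ι := Option (Fin 4)) (g := fun o => o.elim p q) (a := 1)
    (fun _ => zero_le_one) (f := fun z => p z + ∑ j, b j * q j z)
    (hp.add (continuous_finsetSum _ fun j _ => continuous_const.mul (hq j))) hc
    (fun o => by cases o <;> simp [hp, hq]) (fun o => by cases o <;> simp [hpc, hqc])
    (fun z => by
      simp only [Fintype.sum_option, Option.elim, Pi.one_apply, one_mul]
      refine (abs_add_le _ _).trans (add_le_add_right ((Finset.abs_sum_le_sum_abs _ _).trans
        (Finset.sum_le_sum fun j _ => ?_)) _)
      rw [abs_mul]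
      exact mul_le_of_le_one_left (abs_nonneg _) (hb j)) t
  refine h.trans ?_
  simp only [Fintype.sum_option, Option.elim, Pi.one_apply, one_mul, Fin.sum_univ_four]
  linarith [hqM 0, hqM 1, hqM 2, hqM 3]

lemma L2x_opIter_pd_opIter_le {w : (Fin 4 → ℝ) → ℝ} (hw : ContDiff ℝ (⊤ : ℕ∞) w)
    (hc : HasCompactSupport w) (t : ℝ) {N : ℕ} (L : List (Fin 10)) :
    ∀ (L' : List (Fin 10)) (i : Fin 4), L'.length + L.length < N →
      L2x (opIter GammaField L' (pd i (opIter GammaField L w))) t ≤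
        5 ^ L.length * gammaGradSum w t N := by
  induction L with
  | nil =>
    intro L' i h
    simpa [opIter] using L2x_le_gammaGradSum w t h i
  | cons c L ih =>
    intro L' i h
    obtain ⟨b, hb, hcomm⟩ := exists_pd_gammaField c i
    have hs := contDiff_opIter L hw
    have hsc := hasCompactSupport_opIter L hc
    change L2x (opIter GammaField L' (pd i (GammaField c (opIter GammaField L w)))) t ≤ _
    rw [hcomm _ hs, opIter_add_sum_mul L' b (contDiff_gammaField c (contDiff_pd i hs))
      fun j => contDiff_pd j hs, List.length_cons, pow_succ', mul_assoc]
    refine L2x_add_sum_mul_le hb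
      (contDiff_opIter _ (contDiff_gammaField c (contDiff_pd i hs))).continuous
      (hasCompactSupport_opIter _ (hasCompactSupport_gammaField c (hasCompactSupport_pd i hsc)))
      (fun j => (contDiff_opIter _ (contDiff_pd j hs)).continuous)
      (fun j => hasCompactSupport_opIter _ (hasCompactSupport_pd j hsc)) ?_ fun j => ?_
    · have := ih (L' ++ [c]) i (by simp at h ⊢; omega)
      rwa [opIter_append] at this
    · exact ih L' j (by simp at h; omega)

lemma L2x_coneWeight_pd_gammaField_pd_le {w : (Fin 4 → ℝ) → ℝ} (hw : ContDiff ℝ (⊤ : ℕ∞) w)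
    (hc : HasCompactSupport w) (t : ℝ) {N : ℕ} {L : List (Fin 10)} (h : L.length + 1 < N)
    (c : Fin 10) (i l : Fin 4) :
    L2x (fun z => coneWeight z * pd l (GammaField c (pd i (opIter GammaField L w))) z) t ≤
      5 * weightedHessSum w t N := by
  obtain ⟨b, hb, hcomm⟩ := exists_pd_gammaField c i
  have hs := contDiff_opIter L hw
  have hsc := hasCompactSupport_opIter L hc
  set u := opIter GammaField L w
  have h1 : GammaField c (pd i u) = fun z => pd i (GammaField c u) z + ∑ j, -b j * pd j u z := by
    rw [hcomm _ hs]
    funext z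
    simp
  have h2 : (fun z => coneWeight z * pd l (GammaField c (pd i u)) z) =
      fun z => coneWeight z * pd l (pd i (GammaField c u)) z +
        ∑ j, -b j * (coneWeight z * pd l (pd j u) z) := by
    funext z
    rw [h1, pd_add_sum_mul l _ (contDiff_pd i (contDiff_gammaField c hs))
      fun j => contDiff_pd j hs, mul_add, Finset.mul_sum]
    simp_rw [mul_left_comm]
  rw [h2]
  refine L2x_add_sum_mul_le (fun j => by rw [abs_neg]; exact hb j)
    (continuous_coneWeight.mul
      (contDiff_pd l (contDiff_pd i (contDiff_gammaField c hs))).continuous)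
    (hasCompactSupport_pd l (hasCompactSupport_pd i (hasCompactSupport_gammaField c hsc))).mul_left
    (fun j => continuous_coneWeight.mul (contDiff_pd l (contDiff_pd j hs)).continuous)
    (fun j => (hasCompactSupport_pd l (hasCompactSupport_pd j hsc)).mul_left) ?_ fun j => ?_
  · exact L2x_le_weightedHessSum w t (L := c :: L) h l i
  · exact L2x_le_weightedHessSum w t (L := L) (by omega) l j

/-- Unweighted companion of `exists_sqrt_norm_mul_enorm_le`, obtained by translating an arbitrary
point to the unit sphere. -/
lemma exists_enorm_le_sum_eLpNorm_fderiv : ∃ C : ℝ≥0,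
    ∀ (ι : Type) [Fintype ι] (f : EuclideanSpace ℝ (Fin 3) → ℝ)
      (h : ι → EuclideanSpace ℝ (Fin 3) → ℝ) (x : EuclideanSpace ℝ (Fin 3)),
      ContDiff ℝ 1 f → (∀ i, ContDiff ℝ 1 (h i)) → (∀ i, HasCompactSupport (h i)) →
      (∀ y v, ‖v‖ = 1 → |f y| + |fderiv ℝ f y v| ≤ ∑ i, |h i y|) →
      ‖f x‖ₑ ≤ C * ∑ i, eLpNorm (fderiv ℝ (h i)) 2 volume := by
  obtain ⟨C, hC⟩ := exists_sqrt_norm_mul_enorm_le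
  refine ⟨C, fun ι _ f h x hf hh hc H => ?_⟩
  obtain ⟨e, he⟩ : ∃ e : EuclideanSpace ℝ (Fin 3), ‖e‖ = 1 := ⟨_, norm_spherePoint 0 0⟩
  have hadd : ContDiff ℝ 1 fun y : EuclideanSpace ℝ (Fin 3) => y + (x - e) :=
    contDiff_id.add contDiff_const
  have key := hC ι (fun y => f (y + (x - e))) (fun i y => h i (y + (x - e))) e
    (norm_ne_zero_iff.1 (by rw [he]; exact one_ne_zero)) (hf.comp hadd)
    (fun i => (hh i).comp hadd)
    (fun i => (hc i).comp_homeomorph (Homeomorph.addRight (x - e))) fun y v _ hv _ => by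
      rw [fderiv_comp_add_right]
      exact H _ v (hv.trans he)
  have hnorm : ∀ i, eLpNorm (fderiv ℝ fun y => h i (y + (x - e))) 2 volume =
      eLpNorm (fderiv ℝ (h i)) 2 volume := fun i => by
    rw [show (fderiv ℝ fun y => h i (y + (x - e))) = fderiv ℝ (h i) ∘ fun y => y + (x - e) from
      funext fun y => fderiv_comp_add_right _]
    exact eLpNorm_comp_measurePreserving
      ((hh i).continuous_fderiv one_ne_zero).aestronglyMeasurable
      (measurePreserving_add_right volume (x - e))
  simpa [he, hnorm] using key

lemma abs_sum_mul_le_of_orthogonal {y v : Fin 3 → ℝ} (P : Fin 3 → ℝ) {R : ℝ} (hR : 0 < R)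
    (hy : y 0 ^ 2 + y 1 ^ 2 + y 2 ^ 2 = R ^ 2) (hv : v 0 ^ 2 + v 1 ^ 2 + v 2 ^ 2 = R ^ 2)
    (h : y 0 * v 0 + y 1 * v 1 + y 2 * v 2 = 0) :
    |∑ k, v k * P k| ≤ |y 0 * P 1 - y 1 * P 0| + |y 0 * P 2 - y 2 * P 0| +
      |y 1 * P 2 - y 2 * P 1| := by
  have hR2 : 0 < R ^ 2 := by positivity
  have lagrange : R ^ 2 * ∑ k, v k * P k =
      (y 0 * v 1 - y 1 * v 0) * (y 0 * P 1 - y 1 * P 0) +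
      (y 0 * v 2 - y 2 * v 0) * (y 0 * P 2 - y 2 * P 0) +
      (y 1 * v 2 - y 2 * v 1) * (y 1 * P 2 - y 2 * P 1) := by
    rw [← hy, Fin.sum_univ_three]
    linear_combination (y 0 * P 0 + y 1 * P 1 + y 2 * P 2) * h
  have hsum : (y 0 * v 1 - y 1 * v 0) ^ 2 + (y 0 * v 2 - y 2 * v 0) ^ 2 +
      (y 1 * v 2 - y 2 * v 1) ^ 2 = (R ^ 2) ^ 2 := by
    linear_combination (v 0 ^ 2 + v 1 ^ 2 + v 2 ^ 2) * hy + R ^ 2 * hv -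
      (y 0 * v 0 + y 1 * v 1 + y 2 * v 2) * h
  have h01 : |y 0 * v 1 - y 1 * v 0| ≤ R ^ 2 := abs_le_of_sq_le_sq (by
    nlinarith [sq_nonneg (y 0 * v 2 - y 2 * v 0), sq_nonneg (y 1 * v 2 - y 2 * v 1)]) hR2.le
  have h02 : |y 0 * v 2 - y 2 * v 0| ≤ R ^ 2 := abs_le_of_sq_le_sq (by
    nlinarith [sq_nonneg (y 0 * v 1 - y 1 * v 0), sq_nonneg (y 1 * v 2 - y 2 * v 1)]) hR2.le
  have h12 : |y 1 * v 2 - y 2 * v 1| ≤ R ^ 2 := abs_le_of_sq_le_sq (by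
    nlinarith [sq_nonneg (y 0 * v 1 - y 1 * v 0), sq_nonneg (y 0 * v 2 - y 2 * v 0)]) hR2.le
  refine le_of_mul_le_mul_left ?_ hR2
  rw [← abs_of_pos hR2, ← abs_mul, lagrange, abs_of_pos hR2, mul_add, mul_add]
  refine (abs_add_three _ _ _).trans ?_
  simp only [abs_mul]
  gcongr

/-- The smooth weight times `g` (for `none`) or times one of the `Γ g`. -/
def weightedFamily (g : (Fin 4 → ℝ) → ℝ) (o : Option (Fin 10)) (z : Fin 4 → ℝ) : ℝ :=
  smoothConeWeight z * o.elim g (fun c => GammaField c g) z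

lemma contDiff_elim_gammaField {g : (Fin 4 → ℝ) → ℝ} (hg : ContDiff ℝ (⊤ : ℕ∞) g)
    (o : Option (Fin 10)) : ContDiff ℝ (⊤ : ℕ∞) (o.elim g fun c => GammaField c g) := by
  cases o with
  | none => exact hg
  | some c => exact contDiff_gammaField c hg

lemma hasCompactSupport_elim_gammaField {g : (Fin 4 → ℝ) → ℝ} (hc : HasCompactSupport g)
    (o : Option (Fin 10)) : HasCompactSupport (o.elim g fun c => GammaField c g) := by
  cases o with
  | none => exact hc
  | some c => exact hasCompactSupport_gammaField c hc

lemma contDiff_weightedFamily {g : (Fin 4 → ℝ) → ℝ} (hg : ContDiff ℝ (⊤ : ℕ∞) g)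
    (o : Option (Fin 10)) : ContDiff ℝ (⊤ : ℕ∞) (weightedFamily g o) :=
  contDiff_smoothConeWeight.mul (contDiff_elim_gammaField hg o)

lemma hasCompactSupport_weightedFamily {g : (Fin 4 → ℝ) → ℝ} (hc : HasCompactSupport g)
    (o : Option (Fin 10)) : HasCompactSupport (weightedFamily g o) :=
  (hasCompactSupport_elim_gammaField hc o).mul_left

lemma pd_weightedFamily {g : (Fin 4 → ℝ) → ℝ} (hg : ContDiff ℝ (⊤ : ℕ∞) g)
    (o : Option (Fin 10)) (i : Fin 4) (z : Fin 4 → ℝ) :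
    pd i (weightedFamily g o) z =
      pd i smoothConeWeight z * o.elim g (fun c => GammaField c g) z +
        smoothConeWeight z * pd i (o.elim g fun c => GammaField c g) z :=
  pd_mul i contDiff_smoothConeWeight (contDiff_elim_gammaField hg o) z

lemma tangential_le_sum_weightedFamily {g : (Fin 4 → ℝ) → ℝ} (hg : ContDiff ℝ (⊤ : ℕ∞) g)
    (t : ℝ) {R : ℝ} (hR : 0 < R) {y v : EuclideanSpace ℝ (Fin 3)} (hy : ‖y‖ = R) (hv : ‖v‖ = R)
    (hyv : inner ℝ y v = 0) :
    |timeSlice t (weightedFamily g none) y| +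
        |fderiv ℝ (timeSlice t (weightedFamily g none)) y v| ≤
      ∑ o, |timeSlice t (weightedFamily g o) y| := by
  rw [Fintype.sum_option, fderiv_timeSlice (contDiff_weightedFamily hg none)]
  gcongr
  have hy' : y 0 ^ 2 + y 1 ^ 2 + y 2 ^ 2 = R ^ 2 := by
    rw [← hy, EuclideanSpace.real_norm_sq_eq, Fin.sum_univ_three]
  have hv' : v 0 ^ 2 + v 1 ^ 2 + v 2 ^ 2 = R ^ 2 := by
    rw [← hv, EuclideanSpace.real_norm_sq_eq, Fin.sum_univ_three]
  have hyv' : y 0 * v 0 + y 1 * v 1 + y 2 * v 2 = 0 := by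
    rw [← hyv, PiLp.inner_apply, Fin.sum_univ_three]
    simp [mul_comm]
  refine (abs_sum_mul_le_of_orthogonal _ hR hy' hv' hyv').trans ?_
  set z : Fin 4 → ℝ := Fin.cons t (WithLp.ofLp y)
  have hz : ∀ k : Fin 3, y k = z k.succ := fun _ => rfl
  have hrot : ∀ j k : Fin 3, y j * timeSlice t (pd k.succ (weightedFamily g none)) y -
      y k * timeSlice t (pd j.succ (weightedFamily g none)) y =
      smoothConeWeight z * (z j.succ * pd k.succ g z - z k.succ * pd j.succ g z) := by
    intro j k
    change y j * pd k.succ _ z - y k * pd j.succ _ z = _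
    rw [pd_weightedFamily hg, pd_weightedFamily hg, hz, hz]
    simp only [Option.elim]
    linear_combination g z * rotation_smoothConeWeight j k z
  rw [hrot, hrot, hrot]
  calc _ = ∑ c ∈ ({4, 5, 6} : Finset (Fin 10)), |timeSlice t (weightedFamily g (some c)) y| := by
        rw [Finset.sum_insert (by decide), Finset.sum_insert (by decide), Finset.sum_singleton,
          ← add_assoc]
        rfl
    _ ≤ _ := Finset.sum_le_univ_sum_of_nonneg fun _ => abs_nonneg _

lemma gammaField_succ (k : Fin 3) (g : (Fin 4 → ℝ) → ℝ) :
    GammaField (Fin.castLE (by norm_num) k.succ) g = pd k.succ g := by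
  fin_cases k <;> rfl

lemma gradient_le_sum_weightedFamily {g : (Fin 4 → ℝ) → ℝ} (hg : ContDiff ℝ (⊤ : ℕ∞) g)
    (t : ℝ) {y v : EuclideanSpace ℝ (Fin 3)} (hv : ‖v‖ = 1) :
    |timeSlice t (weightedFamily g none) y| +
        |fderiv ℝ (timeSlice t (weightedFamily g none)) y v| ≤
      4 * ∑ o, |timeSlice t (weightedFamily g o) y| := by
  set S := ∑ o, |timeSlice t (weightedFamily g o) y| with hS
  set z : Fin 4 → ℝ := Fin.cons t (WithLp.ofLp y)
  have hf : |timeSlice t (weightedFamily g none) y| ≤ S :=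
    Finset.single_le_sum (f := fun o => |timeSlice t (weightedFamily g o) y|)
      (fun _ _ => abs_nonneg _) (Finset.mem_univ _)
  have hp : ∀ k : Fin 3, |v k * timeSlice t (pd k.succ (weightedFamily g none)) y| ≤ S := by
    intro k
    rw [abs_mul]
    refine (mul_le_of_le_one_left (abs_nonneg _) (hv ▸ PiLp.norm_apply_le v k)).trans ?_
    change |pd k.succ (weightedFamily g none) z| ≤ S
    rw [pd_weightedFamily hg]
    refine (abs_add_le _ _).trans ?_
    have h1 : |smoothConeWeight z * pd k.succ g z| ≤
        ∑ c, |timeSlice t (weightedFamily g (some c)) y| := by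
      rw [← gammaField_succ]
      exact Finset.single_le_sum (f := fun c => |timeSlice t (weightedFamily g (some c)) y|)
        (fun _ _ => abs_nonneg _) (Finset.mem_univ _)
    have h2 : |pd k.succ smoothConeWeight z * g z| ≤ |timeSlice t (weightedFamily g none) y| := by
      change _ ≤ |smoothConeWeight z * g z|
      rw [abs_mul, abs_mul]
      exact mul_le_mul_of_nonneg_right ((abs_pd_smoothConeWeight_le k z).trans
        ((one_le_smoothConeWeight z).trans (le_abs_self _))) (abs_nonneg _)
    rw [hS, Fintype.sum_option]
    exact add_le_add h2 h1
  rw [fderiv_timeSlice (contDiff_weightedFamily hg none)]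
  have := Finset.abs_sum_le_sum_abs
    (fun k : Fin 3 => v k * timeSlice t (pd k.succ (weightedFamily g none)) y) Finset.univ
  have h3 := this.trans (Finset.sum_le_sum fun k _ => hp k)
  simp at h3
  linarith

/-- Pointwise bound for a smooth compactly supported function with both weights. -/
lemma exists_weighted_sobolev : ∃ C : ℝ≥0, ∀ (g : (Fin 4 → ℝ) → ℝ), ContDiff ℝ (⊤ : ℕ∞) g →
    HasCompactSupport g → ∀ (t : ℝ) (x : EuclideanSpace ℝ (Fin 3)),
      ENNReal.ofReal (1 + √‖x‖) * ‖timeSlice t (weightedFamily g none) x‖ₑ ≤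
        C * ∑ o, eLpNorm (fderiv ℝ (timeSlice t (weightedFamily g o))) 2 volume := by
  obtain ⟨C₁, hC₁⟩ := exists_sqrt_norm_mul_enorm_le
  obtain ⟨C₂, hC₂⟩ := exists_enorm_le_sum_eLpNorm_fderiv
  refine ⟨C₂ * 4 + C₁, fun g hg hc t x => ?_⟩
  have hd : ∀ o, ContDiff ℝ 1 (timeSlice t (weightedFamily g o)) := fun o =>
    contDiff_timeSlice (contDiff_weightedFamily hg o) t
  have hs : ∀ o, HasCompactSupport (timeSlice t (weightedFamily g o)) := fun o =>
    hasCompactSupport_timeSlice (hasCompactSupport_weightedFamily hc o) t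
  have h2 := hC₂ (Fin 4 × Option (Fin 10)) (timeSlice t (weightedFamily g none))
    (fun p => timeSlice t (weightedFamily g p.2)) x (hd _) (fun _ => hd _) (fun _ => hs _)
    fun y v hv => by
      rw [Fintype.sum_prod_type]
      simpa [mul_add] using gradient_le_sum_weightedFamily hg t (y := y) hv
  rw [Fintype.sum_prod_type] at h2
  have h1 : ENNReal.ofReal √‖x‖ * ‖timeSlice t (weightedFamily g none) x‖ₑ ≤
      C₁ * ∑ o, eLpNorm (fderiv ℝ (timeSlice t (weightedFamily g o))) 2 volume := by
    rcases eq_or_ne x 0 with rfl | hx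
    · simp
    · exact hC₁ _ _ _ x hx (hd _) hd hs fun y v hy hv hyv =>
        tangential_le_sum_weightedFamily hg t (norm_pos_iff.2 hx) hy hv hyv
  rw [ENNReal.ofReal_add zero_le_one (Real.sqrt_nonneg _), add_mul, ENNReal.ofReal_one, one_mul]
  push_cast
  rw [add_mul]
  refine add_le_add (h2.trans_eq ?_) h1
  simp [mul_assoc, mul_add]

lemma L2x_pd_weightedFamily_le {g : (Fin 4 → ℝ) → ℝ} (hg : ContDiff ℝ (⊤ : ℕ∞) g)
    (hc : HasCompactSupport g) (t : ℝ) (o : Option (Fin 10)) (k : Fin 3) :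
    L2x (pd k.succ (weightedFamily g o)) t ≤ L2x (o.elim g fun c => GammaField c g) t +
      2 * L2x (fun z => coneWeight z * pd k.succ (o.elim g fun c => GammaField c g) z) t := by
  have hd := contDiff_elim_gammaField hg o
  have hs := hasCompactSupport_elim_gammaField hc o
  have h := L2x_le_sum_mul (f := pd k.succ (weightedFamily g o)) (a := ![1, 2])
    (g := ![o.elim g fun c => GammaField c g,
      fun z => coneWeight z * pd k.succ (o.elim g fun c => GammaField c g) z])
    (by simp [Fin.forall_fin_two]) (contDiff_pd _ (contDiff_weightedFamily hg o)).continuous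
    (hasCompactSupport_pd _ (hasCompactSupport_weightedFamily hc o))
    (Fin.forall_fin_two.2 ⟨hd.continuous,
      continuous_coneWeight.mul (contDiff_pd _ hd).continuous⟩)
    (Fin.forall_fin_two.2 ⟨hs, (hasCompactSupport_pd _ hs).mul_left⟩)
    (fun z => by
      rw [pd_weightedFamily hg, Fin.sum_univ_two]
      refine (abs_add_le _ _).trans ?_
      simp only [Matrix.cons_val_zero, Matrix.cons_val_one, one_mul, abs_mul]
      rw [abs_of_nonneg (coneWeight_nonneg z), ← mul_assoc,
        abs_of_pos (zero_lt_one.trans_le (one_le_smoothConeWeight z))]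
      gcongr
      · exact mul_le_of_le_one_left (abs_nonneg _) (abs_pd_smoothConeWeight_le k z)
      · exact smoothConeWeight_le z) t
  simpa [Fin.sum_univ_two] using h

lemma sum_eLpNorm_fderiv_weightedFamily_le {w : (Fin 4 → ℝ) → ℝ} (hw : ContDiff ℝ (⊤ : ℕ∞) w)
    (hc : HasCompactSupport w) (L : List (Fin 10)) (t : ℝ) (i : Fin 4) :
    ∑ o, eLpNorm (fderiv ℝ (timeSlice t (weightedFamily (pd i (opIter GammaField L w)) o))) 2
        volume ≤
      ENNReal.ofReal (33 * (5 ^ L.length * gammaGradSum w t (L.length + 2) +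
        10 * weightedHessSum w t (L.length + 2))) := by
  have hg := contDiff_pd i (contDiff_opIter L hw)
  have hgc := hasCompactSupport_pd i (hasCompactSupport_opIter L hc)
  set g := pd i (opIter GammaField L w)
  set A := gammaGradSum w t (L.length + 2)
  set D := weightedHessSum w t (L.length + 2)
  have hA : ∀ o : Option (Fin 10), L2x (o.elim g fun c => GammaField c g) t ≤
      5 ^ L.length * A := by
    intro o
    cases o with
    | none => exact L2x_opIter_pd_opIter_le hw hc t L [] i (by simp)
    | some c => exact L2x_opIter_pd_opIter_le hw hc t L [c] i (by simp; omega)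
  have hD : ∀ (o : Option (Fin 10)) (k : Fin 3),
      L2x (fun z => coneWeight z * pd k.succ (o.elim g fun c => GammaField c g) z) t ≤ 5 * D := by
    intro o k
    cases o with
    | none =>
      have := L2x_le_weightedHessSum w t (show L.length < L.length + 2 by omega) k.succ i
      exact this.trans (by linarith [weightedHessSum_nonneg w t (L.length + 2)])
    | some c => exact L2x_coneWeight_pd_gammaField_pd_le hw hc t (by omega) c i k.succ
  calc _ ≤ ∑ o : Option (Fin 10), ∑ k : Fin 3,
        ENNReal.ofReal (L2x (pd k.succ (weightedFamily g o)) t) :=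
        Finset.sum_le_sum fun o _ => eLpNorm_fderiv_timeSlice_le (contDiff_weightedFamily hg o)
          (hasCompactSupport_weightedFamily hgc o) t
    _ ≤ ∑ o : Option (Fin 10), ∑ k : Fin 3, ENNReal.ofReal (5 ^ L.length * A + 10 * D) :=
        Finset.sum_le_sum fun o _ => Finset.sum_le_sum fun k _ => ENNReal.ofReal_le_ofReal <|
          (L2x_pd_weightedFamily_le hg hgc t o k).trans (by linarith [hA o, hD o k])
    _ = _ := by
        rw [ENNReal.ofReal_mul (by norm_num)]
        simp [← mul_assoc]
        norm_num

lemma sqrt_sqrt_one_add_sq_le {a : ℝ} (ha : 0 ≤ a) : √√(1 + a ^ 2) ≤ 1 + √a := by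
  have h1 : √(1 + a ^ 2) ≤ 1 + a := Real.sqrt_le_iff.2 ⟨by linarith, by nlinarith⟩
  refine Real.sqrt_le_iff.2 ⟨by positivity, h1.trans ?_⟩
  nlinarith [Real.sq_sqrt ha, Real.sqrt_nonneg a]

/-- Hidano-type weighted estimate: for every multi-index length `m` there is
a constant `C` such that for every `w ∈ C₀^∞(ℝ₊×ℝ³)`, every product `Γ^α` of `|α| ≤ m` vector
fields from `Γ`, every `t ≥ 0` and `x ∈ ℝ³`,
`⟨r⟩^{1/2}⟨t-r⟩ |∂Γ^α w(t,x)| ≤ C Σ_{|β|≤|α|+1} ‖Γ^β ∂w(t,·)‖₂ + C Σ_{|β|≤|α|+1} ‖⟨t-r⟩ ∂²Γ^β w(t,·)‖₂`. -/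
theorem stmt4 (m : ℕ) :
    ∃ C : ℝ, 0 < C ∧
      ∀ w : (Fin 4 → ℝ) → ℝ, ContDiff ℝ (⊤ : ℕ∞) w → HasCompactSupport w →
        ∀ L : List (Fin 10), L.length ≤ m →
          ∀ t : ℝ, 0 ≤ t → ∀ x : Fin 3 → ℝ, ∀ i : Fin 4,
            Real.sqrt (Real.sqrt (1 + ((x 0)^2 + (x 1)^2 + (x 2)^2))) *
                Real.sqrt (1 + (t - Real.sqrt ((x 0)^2 + (x 1)^2 + (x 2)^2))^2) *
                |pd i (opIter GammaField L w) (Fin.cons t x)| ≤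
              C * (∑ n ∈ Finset.range (L.length + 2), ∑ σ : Fin n → Fin 10, ∑ j : Fin 4,
                    L2x (opIter GammaField (List.ofFn σ) (pd j w)) t) +
              C * (∑ n ∈ Finset.range (L.length + 2), ∑ σ : Fin n → Fin 10,
                    ∑ j : Fin 4, ∑ k : Fin 4,
                    L2x (fun z => Real.sqrt (1 + (z 0 - rad z)^2) *
                      pd j (pd k (opIter GammaField (List.ofFn σ) w)) z) t) := by
  obtain ⟨C, hC⟩ := exists_weighted_sobolev
  refine ⟨66 * C * (5 ^ m + 10) + 1, by positivity, fun w hw hc L hL t _ x i => ?_⟩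
  change √√(1 + (x 0 ^ 2 + x 1 ^ 2 + x 2 ^ 2)) * coneWeight (Fin.cons t x) * _ ≤
    _ * gammaGradSum w t (L.length + 2) + _ * weightedHessSum w t (L.length + 2)
  have hA := gammaGradSum_nonneg w t (L.length + 2)
  have hD := weightedHessSum_nonneg w t (L.length + 2)
  have hsum := sum_eLpNorm_fderiv_weightedFamily_le hw hc L t i
  have key := hC _ (contDiff_pd i (contDiff_opIter L hw))
    (hasCompactSupport_pd i (hasCompactSupport_opIter L hc)) t (WithLp.toLp 2 x)
  set g := pd i (opIter GammaField L w)
  set A := gammaGradSum w t (L.length + 2)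
  set D := weightedHessSum w t (L.length + 2)
  set z : Fin 4 → ℝ := Fin.cons t x
  have hbound : (1 + √‖WithLp.toLp 2 x‖) * (smoothConeWeight z * |g z|) ≤
      C * (33 * (5 ^ L.length * A + 10 * D)) := by
    have h := key.trans (mul_le_mul_right hsum _)
    rw [← ENNReal.ofReal_coe_nnreal, ← ENNReal.ofReal_mul C.coe_nonneg, Real.enorm_eq_ofReal_abs,
      ← ENNReal.ofReal_mul (by positivity), ENNReal.ofReal_le_ofReal_iff (by positivity)] at h
    change _ * |smoothConeWeight z * g z| ≤ _ at h
    rwa [abs_mul, abs_of_pos (zero_lt_one.trans_le (one_le_smoothConeWeight z))] at h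
  have hnorm : x 0 ^ 2 + x 1 ^ 2 + x 2 ^ 2 = ‖WithLp.toLp 2 x‖ ^ 2 := by
    rw [EuclideanSpace.real_norm_sq_eq, Fin.sum_univ_three]
  have hpow : (5 : ℝ) ^ L.length ≤ 5 ^ m := pow_le_pow_right₀ (by norm_num) hL
  calc √√(1 + (x 0 ^ 2 + x 1 ^ 2 + x 2 ^ 2)) * coneWeight z * |g z|
      ≤ (1 + √‖WithLp.toLp 2 x‖) * (2 * smoothConeWeight z) * |g z| := by
        rw [hnorm]
        gcongr
        · exact coneWeight_nonneg z
        · exact sqrt_sqrt_one_add_sq_le (norm_nonneg _)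
        · exact coneWeight_le z
    _ = 2 * ((1 + √‖WithLp.toLp 2 x‖) * (smoothConeWeight z * |g z|)) := by ring
    _ ≤ 2 * (C * (33 * (5 ^ L.length * A + 10 * D))) := by gcongr
    _ ≤ 2 * (C * (33 * (5 ^ m * A + 10 * D))) := by gcongr
    _ ≤ (66 * C * (5 ^ m + 10) + 1) * A + (66 * C * (5 ^ m + 10) + 1) * D := by
        have h1 : 0 ≤ (C : ℝ) * A := by positivity
        have h2 : 0 ≤ (C : ℝ) * 5 ^ m * D := by positivity
        linarith
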